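/- arXiv:1604.06137 — 11 statements merged into one kernel-verified Lean document; each statement's English description precedes it below -/
import Mathlib

section
/- Let P and Q be two distinct points of PG(2,q²) with P ∉ U and Q ∉ U. Then the set τ_P(U) ∩ τ_Q(U) contains at most one point. -/
noncomputable section
open Projectivization
open scoped LinearAlgebra.Projectivization

/-- `Pt K` is the point set of `PG(2, q²)`, i.e. the projectivization of `K³`. -/
abbrev Pt (K : Type) [Field K] : Type := ℙ K (Fin 3 → K)

lemma vec1_ne_zero {K : Type} [Field K] (a b : K) : ![a, b, (1 : K)] ≠ 0 := by
  intro h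
  have := congrFun h 2
  simp at this

lemma vecInf_ne_zero {K : Type} [Field K] : ![(0 : K), 1, 0] ≠ 0 := by
  intro h
  have := congrFun h 1
  simp at this

lemma vec100_ne_zero {K : Type} [Field K] : ![(1 : K), 0, 0] ≠ 0 := by
  intro h
  have := congrFun h 0
  simp at this

/-- The orthogonal-Buekenhout-Metz unital
`U = {[x, αx² + βN(x) + r, 1] : x ∈ K, r ∈ GF(q)} ∪ {[0,1,0]}`,
where `GF(q) = {r : r^q = r}` and `N(x) = x^(q+1)`. -/
def unital (K : Type) [Field K] (q : ℕ) (α β : K) : Set (Pt K) :=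
  {P | (∃ x r : K, r ^ q = r ∧
      P = Projectivization.mk K ![x, α * x ^ 2 + β * x ^ (q + 1) + r, 1] (vec1_ne_zero _ _)) ∨
    P = Projectivization.mk K ![0, 1, 0] vecInf_ne_zero}

/-- The line through two points `A`, `B`: all points `[w]` with `w ∈ span{u, v}` where
`A = [u]`, `B = [v]`. -/
def lineThrough {K : Type} [Field K] (A B : Pt K) : Set (Pt K) :=
  {C | C.submodule ≤ A.submodule ⊔ B.submodule}

/-- The pedal `τ_P(U)` of `P`: the set of feet of `P`, i.e. points `A ∈ U` such that `A`
is the only point of `U` on the line through `P` and `A`. -/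
def pedal {K : Type} [Field K] (U : Set (Pt K)) (P : Pt K) : Set (Pt K) :=
  {A | A ∈ U ∧ lineThrough P A ∩ U = {A}}

/-- The form `αv² - ᾱv̄² + (β - β̄)vv̄` is anisotropic when its discriminant is not the square of
a fixed element of the involution `σ`. -/
lemma form_ne_zero {K : Type} [Field K] (σ : K →+* K) (hσ : ∀ x, σ (σ x) = x) (α β : K)
    (hns : ¬ ∃ s : K, σ s = s ∧ 4 * (α * σ α) + (σ β - β) ^ 2 = s ^ 2) {v : K} (hv : v ≠ 0) :
    α * v ^ 2 - σ α * σ v ^ 2 + (β - σ β) * (v * σ v) ≠ 0 := by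
  intro h
  have hv' : σ v ≠ 0 := (map_ne_zero σ).2 hv
  refine hns ⟨(α * v ^ 2 + σ α * σ v ^ 2) / (v * σ v), ?_, ?_⟩
  · simp only [map_div₀, map_add, map_mul, map_pow, hσ]
    rw [add_comm, mul_comm v]
  · rw [div_pow, eq_div_iff (pow_ne_zero 2 (mul_ne_zero hv hv'))]
    linear_combination ((β - σ β) * (v * σ v) - (α * v ^ 2 - σ α * σ v ^ 2)) * h

lemma exists_nontrivial_zero {K : Type} [Field K] (σ : K →+* K) (hσ : ∀ x, σ (σ x) = x)
    (hw : ∃ w, σ w ≠ w) (α β : K)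
    (hns : ¬ ∃ s : K, σ s = s ∧ 4 * (α * σ α) + (σ β - β) ^ 2 = s ^ 2) {c : K} (hc : c ≠ 0) :
    ∃ u, u ≠ 0 ∧
      α * u ^ 2 - σ α * σ u ^ 2 + (β - σ β) * (u * σ u) + (c * u - σ c * σ u) = 0 := by
  obtain ⟨w, hw⟩ := hw
  have hw0 : w ≠ 0 := by rintro rfl; simp at hw
  have hv : w / c ≠ 0 := div_ne_zero hw0 hc
  have hQ := form_ne_zero σ hσ α β hns hv
  have hcv : c * (w / c) = w := mul_div_cancel₀ w hc
  have hcv' : σ c * σ (w / c) = σ w := by rw [← map_mul, hcv]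
  generalize w / c = v at *
  have hL : w - σ w ≠ 0 := sub_ne_zero.2 hw.symm
  set D := α * v ^ 2 - σ α * σ v ^ 2 + (β - σ β) * (v * σ v) with hD
  have hσD : σ D = -D := by
    simp only [hD, map_add, map_sub, map_mul, map_pow, hσ]; ring
  set t := -(w - σ w) / D with ht
  have hσt : σ t = t := by
    rw [ht, map_div₀, hσD]; simp only [map_neg, map_sub, hσ]
    rw [div_neg, ← neg_div]; ring
  have htD : t * D = -(w - σ w) := div_mul_cancel₀ _ hQ
  refine ⟨t * v, mul_ne_zero (div_ne_zero (neg_ne_zero.2 hL) hQ) hv, ?_⟩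
  rw [map_mul, hσt]
  linear_combination t * htD + t * hcv - t * hcv' - t ^ 2 * hD

lemma mk_mem_lineThrough {K : Type} [Field K] {u v w : Fin 3 → K} (hu : u ≠ 0) (hv : v ≠ 0)
    (hw : w ≠ 0) :
    Projectivization.mk K w hw ∈ lineThrough (Projectivization.mk K u hu)
      (Projectivization.mk K v hv) ↔ ∃ s t : K, s • u + t • v = w := by
  simp only [lineThrough, Set.mem_ofPred_eq, Projectivization.submodule_mk]
  rw [Submodule.span_singleton_le_iff_mem, ← Submodule.span_union, Set.singleton_union,
    Submodule.mem_span_pair]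

/-- The tangent to the unital at an affine point `[x, y, 1]` has slope
`2αx + (β - β̄)x̄`. -/
lemma tangent_affine {K : Type} [Field K] {q : ℕ} (σ : K →+* K) (hσq : ∀ x, σ x = x ^ q)
    (hσ : ∀ x, σ (σ x) = x) (hw : ∃ w, σ w ≠ w) (α β : K)
    (hns : ¬ ∃ s : K, σ s = s ∧ 4 * (α * σ α) + (σ β - β) ^ 2 = s ^ 2)
    {a : Fin 3 → K} (ha : a ≠ 0) (hP : Projectivization.mk K a ha ∉ unital K q α β)
    {x r : K} (hr : σ r = r)
    (hA : Projectivization.mk K ![x, α * x ^ 2 + β * x ^ (q + 1) + r, 1] (vec1_ne_zero _ _) ∈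
      pedal (unital K q α β) (Projectivization.mk K a ha)) :
    a 0 - x * a 2 ≠ 0 ∧
      a 1 - (α * x ^ 2 + β * x ^ (q + 1) + r) * a 2 =
        (2 * α * x + (β - σ β) * σ x) * (a 0 - x * a 2) := by
  obtain ⟨hAU, hline⟩ := hA
  have uniq : ∀ (w : Fin 3 → K) (hw : w ≠ 0),
      (∃ s t : K, s • a + t • ![x, α * x ^ 2 + β * x ^ (q + 1) + r, 1] = w) →
      Projectivization.mk K w hw ∈ unital K q α β →
      ∃ k : K, k • ![x, α * x ^ 2 + β * x ^ (q + 1) + r, 1] = w := by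
    intro w hw h1 h2
    have := hline.subset ⟨(mk_mem_lineThrough ha (vec1_ne_zero _ _) hw).2 h1, h2⟩
    exact (Projectivization.mk_eq_mk_iff' K _ _ _ _).1 this
  have hd : a 0 - x * a 2 ≠ 0 := by
    intro hd
    have he : a 1 - (α * x ^ 2 + β * x ^ (q + 1) + r) * a 2 ≠ 0 := by
      intro he
      apply hP
      convert hAU using 1
      refine (Projectivization.mk_eq_mk_iff' K _ _ _ _).2 ⟨a 2, ?_⟩
      ext i
      fin_cases i
      · simp; linear_combination -hd
      · simp; linear_combination -he
      · simp
    obtain ⟨k, hk⟩ := uniq _ vecInf_ne_zero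
      ⟨(a 1 - (α * x ^ 2 + β * x ^ (q + 1) + r) * a 2)⁻¹,
        -(a 1 - (α * x ^ 2 + β * x ^ (q + 1) + r) * a 2)⁻¹ * a 2, by
          ext i
          fin_cases i
          · simp
            linear_combination (a 1 - (α * x ^ 2 + β * x ^ (q + 1) + r) * a 2)⁻¹ * hd
          · simp
            linear_combination inv_mul_cancel₀ he
          · simp⟩ (Or.inr rfl)
    have h2 := congrFun hk 2
    have h1 := congrFun hk 1
    simp at h2
    simp [h2] at h1
  refine ⟨hd, ?_⟩
  by_contra hne
  obtain ⟨m, hm⟩ : ∃ m, m * (a 0 - x * a 2) =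
      a 1 - (α * x ^ 2 + β * x ^ (q + 1) + r) * a 2 := ⟨_, div_mul_cancel₀ _ hd⟩
  have hc : 2 * α * x + (β - σ β) * σ x - m ≠ 0 := by
    intro h
    exact hne (by rw [← hm]; linear_combination -(a 0 - x * a 2) * h)
  obtain ⟨u, hu, h⟩ := exists_nontrivial_zero σ hσ hw α β hns hc
  obtain ⟨k, hk⟩ := uniq ![x + u, α * x ^ 2 + β * x ^ (q + 1) + r + m * u, 1] (vec1_ne_zero _ _)
    ⟨u / (a 0 - x * a 2), 1 - u / (a 0 - x * a 2) * a 2, by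
      have hud := div_mul_cancel₀ u hd
      ext i
      fin_cases i
      · simp; linear_combination hud
      · simp; linear_combination m * hud - u / (a 0 - x * a 2) * hm
      · simp⟩
    (Or.inl ⟨x + u, α * x ^ 2 + β * x ^ (q + 1) + r + m * u -
        (α * (x + u) ^ 2 + β * (x + u) ^ (q + 1)), by
      rw [← hσq]
      simp only [pow_succ _ q, ← hσq, map_add, map_sub, map_mul, map_pow, hσ] at h ⊢
      simp only [map_ofNat] at h
      linear_combination hr + h, by simp⟩)
  have h2 := congrFun hk 2
  have h0 := congrFun hk 0
  simp at h2
  simp [h2] at h0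
  exact hu h0

lemma tangent_infinity {K : Type} [Field K] {q : ℕ} (hq : q ≠ 0) (α β : K)
    {a : Fin 3 → K} (ha : a ≠ 0) (hP : Projectivization.mk K a ha ∉ unital K q α β)
    (hA : Projectivization.mk K ![0, 1, 0] vecInf_ne_zero ∈
      pedal (unital K q α β) (Projectivization.mk K a ha)) :
    a 0 ≠ 0 ∧ a 2 = 0 := by
  obtain ⟨hAU, hline⟩ := hA
  have h2 : a 2 = 0 := by
    by_contra h2
    obtain ⟨x, hx⟩ : ∃ x, x * a 2 = a 0 := ⟨_, div_mul_cancel₀ _ h2⟩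
    have hi := inv_mul_cancel₀ h2
    have := hline.subset ⟨(mk_mem_lineThrough ha vecInf_ne_zero
      (vec1_ne_zero x (α * x ^ 2 + β * x ^ (q + 1) + 0))).2
        ⟨(a 2)⁻¹, α * x ^ 2 + β * x ^ (q + 1) - (a 2)⁻¹ * a 1, by
          ext i
          fin_cases i
          · simp; linear_combination x * hi - (a 2)⁻¹ * hx
          · simp
          · simp [hi]⟩, Or.inl ⟨x, 0, by simp [hq], rfl⟩⟩
    obtain ⟨k, hk⟩ := (Projectivization.mk_eq_mk_iff' K _ _ _ _).1 this
    simpa using congrFun hk 2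
  refine ⟨fun h0 => hP ?_, h2⟩
  convert hAU using 1
  refine (Projectivization.mk_eq_mk_iff' K _ _ _ _).2 ⟨a 1, ?_⟩
  ext i
  fin_cases i <;> simp [h0, h2]

/-- A point of the unital lies on a unique tangent: two points with a common foot are collinear
with it. -/
lemma mem_lineThrough_of_common_foot {K : Type} [Field K] {q : ℕ} (σ : K →+* K)
    (hσq : ∀ x, σ x = x ^ q) (hσ : ∀ x, σ (σ x) = x) (hw : ∃ w, σ w ≠ w) (hq : q ≠ 0) (α β : K)
    (hns : ¬ ∃ s : K, σ s = s ∧ 4 * (α * σ α) + (σ β - β) ^ 2 = s ^ 2)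
    {P Q A : Pt K} (hP : P ∉ unital K q α β) (hQ : Q ∉ unital K q α β)
    (hPA : A ∈ pedal (unital K q α β) P) (hQA : A ∈ pedal (unital K q α β) Q) :
    Q ∈ lineThrough P A := by
  induction P using Projectivization.ind with | h a ha =>
  induction Q using Projectivization.ind with | h b hb =>
  rcases hPA.1 with ⟨x, r, hr, rfl⟩ | rfl
  · rw [← hσq] at hr
    obtain ⟨hd, h⟩ := tangent_affine σ hσq hσ hw α β hns ha hP hr hPA
    obtain ⟨-, h'⟩ := tangent_affine σ hσq hσ hw α β hns hb hQ hr hQA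
    have hk := div_mul_cancel₀ (b 0 - x * b 2) hd
    refine (mk_mem_lineThrough _ _ _).2 ⟨(b 0 - x * b 2) / (a 0 - x * a 2),
      b 2 - (b 0 - x * b 2) / (a 0 - x * a 2) * a 2, ?_⟩
    generalize (b 0 - x * b 2) / (a 0 - x * a 2) = k at *
    ext i
    fin_cases i
    · simp; linear_combination hk
    · simp; linear_combination k * h - h' + (2 * α * x + (β - σ β) * σ x) * hk
    · simp
  · obtain ⟨h0, h2⟩ := tangent_infinity hq α β ha hP hPA
    obtain ⟨-, h2'⟩ := tangent_infinity hq α β hb hQ hQA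
    refine (mk_mem_lineThrough _ _ _).2 ⟨b 0 / a 0, b 1 - b 0 / a 0 * a 1, ?_⟩
    ext i
    fin_cases i <;> simp [h0, h2, h2']

lemma mem_lineThrough_of_mem_of_mem {K : Type} [Field K] {P Q A B : Pt K} (hPQ : P ≠ Q)
    (hA : Q ∈ lineThrough P A) (hB : Q ∈ lineThrough P B) : B ∈ lineThrough P A := by
  induction P using Projectivization.ind with | h p hp =>
  induction Q using Projectivization.ind with | h v hv =>
  induction A using Projectivization.ind with | h a ha =>
  induction B using Projectivization.ind with | h b hb =>
  obtain ⟨s, t, h⟩ := (mk_mem_lineThrough _ _ _).1 hA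
  obtain ⟨s', t', h'⟩ := (mk_mem_lineThrough _ _ _).1 hB
  have ht : t' ≠ 0 := by
    rintro rfl
    exact hPQ ((Projectivization.mk_eq_mk_iff' K _ _ _ _).2 ⟨s', by simpa using h'⟩).symm
  refine (mk_mem_lineThrough _ _ _).2 ⟨t'⁻¹ * (s - s'), t'⁻¹ * t, ?_⟩
  have : t' • b = (s - s') • p + t • a := by
    rw [sub_smul, sub_add_eq_add_sub, h, ← h', add_sub_cancel_left]
  rw [mul_smul, mul_smul, ← smul_add, ← this, inv_smul_smul₀ ht]

lemma exists_pow_ne_self {K : Type} [Field K] [Fintype K] {q : ℕ} (hq : 1 < q)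
    (hcard : Fintype.card K = q ^ 2) : ∃ w : K, w ^ q ≠ w := by
  by_contra! h
  have h1 : ∀ x : Kˣ, x ^ (q - 1) = 1 := by
    intro x
    ext
    have := h x
    obtain ⟨m, rfl⟩ : ∃ m, q = m + 1 := ⟨q - 1, by omega⟩
    rw [pow_succ] at this
    simpa using this
  have h2 := Nat.le_of_dvd (by omega) ((FiniteField.forall_pow_eq_one_iff K (q - 1)).1 h1)
  rw [hcard] at h2
  have : q * 2 ≤ q ^ 2 := by nlinarith
  omega

theorem stmt_1 {K : Type} [Field K] [Fintype K] (p n q : ℕ)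
    (hp : p.Prime) (hpodd : Odd p) (hn : 0 < n) (hq : q = p ^ n)
    (hcard : Fintype.card K = q ^ 2)
    (α β : K) (hα : α ≠ 0)
    (hns : ¬ ∃ s : K, s ^ q = s ∧ 4 * α ^ (q + 1) + (β ^ q - β) ^ 2 = s ^ 2)
    (P Q : Pt K) (hPQ : P ≠ Q)
    (hP : P ∉ unital K q α β) (hQ : Q ∉ unital K q α β) :
    (pedal (unital K q α β) P ∩ pedal (unital K q α β) Q).Subsingleton := by
  have : Fact p.Prime := ⟨hp⟩
  have : CharP K p := charP_of_card_eq_prime_pow (f := n * 2) (by rw [hcard, hq, pow_mul])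
  have hq1 : 1 < q := hq ▸ Nat.one_lt_pow hn.ne' hp.one_lt
  obtain ⟨σ, hσq⟩ : ∃ σ : K →+* K, ∀ x, σ x = x ^ q :=
    ⟨iterateFrobenius K p n, fun x => by rw [iterateFrobenius_def, hq]⟩
  have hσ : ∀ x, σ (σ x) = x := fun x => by
    rw [hσq, hσq, ← pow_mul, ← sq, ← hcard, FiniteField.pow_card]
  have hw : ∃ w, σ w ≠ w := by simpa only [hσq] using exists_pow_ne_self hq1 hcard
  have hns' : ¬ ∃ s : K, σ s = s ∧ 4 * (α * σ α) + (σ β - β) ^ 2 = s ^ 2 := by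
    simpa only [hσq, ← pow_succ'] using hns
  rintro A ⟨hPA, hQA⟩ B ⟨hPB, hQB⟩
  have key : ∀ {C}, C ∈ pedal (unital K q α β) P → C ∈ pedal (unital K q α β) Q →
      Q ∈ lineThrough P C :=
    mem_lineThrough_of_common_foot σ hσq hσ hw (by omega) α β hns' hP hQ
  have hB := hPA.2.subset ⟨mem_lineThrough_of_mem_of_mem hPQ (key hPA hQA) (key hPB hQB), hPB.1⟩
  exact (Set.mem_singleton_iff.1 hB).symm
end
end

section
/- Let ℓ be a line of PG(2,q²) that is not tangent to U (i.e. ℓ ∩ U does not consist of exactly one point). Then there exist q+1 points P_0, P_1, …, P_q of PG(2,q²), none in U, with pairwise distinct pedals, such that each set τ_{P_i}(U) ∩ ℓ is a singleton, these singletons are pairwise disjoint, and their union equals ℓ ∩ U. -/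
noncomputable section
open Projectivization
open scoped LinearAlgebra.Projectivization

/-- A line of `PG(2, q²)`: the set of points lying in a fixed 2-dimensional subspace of `K³`. -/
def isLine {K : Type} [Field K] (l : Set (Pt K)) : Prop :=
  ∃ W : Submodule K (Fin 3 → K), Module.finrank K W = 2 ∧ l = {P | P.submodule ≤ W}

/-! ### Norms and squares in a field of order `q²` -/

section FieldOfSquareOrder

variable {K : Type} [Field K] [Fintype K] {q : ℕ}

lemma card_units_eq (hcard : Fintype.card K = q ^ 2) :
    Nat.card Kˣ = (q + 1) * (q - 1) := by
  rw [Nat.card_units, Nat.card_eq_fintype_card, hcard, ← Nat.sq_sub_sq, one_pow]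

/-- Every nonzero element fixed by `x ↦ x ^ q` is the norm of exactly `q + 1` elements. -/
lemma ncard_norm_fiber (hq : 2 ≤ q) (hcard : Fintype.card K = q ^ 2) {k : K} (hk : k ≠ 0)
    (hkq : k ^ q = k) : {y : K | y ^ (q + 1) = k}.ncard = q + 1 := by
  have hU := card_units_eq hcard
  have hker : Nat.card (powMonoidHom (q + 1) : Kˣ →* Kˣ).ker = q + 1 := by
    rw [IsCyclic.card_powMonoidHom_ker, hU, Nat.gcd_mul_right_left]
  have hker' : Nat.card (powMonoidHom (q - 1) : Kˣ →* Kˣ).ker = q - 1 := by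
    rw [IsCyclic.card_powMonoidHom_ker, hU, Nat.gcd_mul_left_left]
  have hle : (powMonoidHom (q + 1) : Kˣ →* Kˣ).range ≤ (powMonoidHom (q - 1) : Kˣ →* Kˣ).ker := by
    rintro _ ⟨y, rfl⟩
    rw [MonoidHom.mem_ker, powMonoidHom_apply, powMonoidHom_apply, ← pow_mul, ← hU, pow_card_eq_one']
  have heq : (powMonoidHom (q + 1) : Kˣ →* Kˣ).range = (powMonoidHom (q - 1) : Kˣ →* Kˣ).ker := by
    apply Subgroup.eq_of_le_of_card_ge hle
    rw [hker', IsCyclic.card_powMonoidHom_range, hU, Nat.gcd_mul_right_left,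
      Nat.mul_div_cancel_left _ (by omega)]
  have hmem : Units.mk0 k hk ∈ (powMonoidHom (q + 1) : Kˣ →* Kˣ).range := by
    rw [heq, MonoidHom.mem_ker, powMonoidHom_apply]
    ext
    have h : k ^ (q - 1) * k = 1 * k := by
      rw [← pow_succ, Nat.sub_add_cancel (by omega), hkq, one_mul]
    simpa using mul_right_cancel₀ hk h
  obtain ⟨z, hz⟩ := hmem
  have hz' : (z : K) ^ (q + 1) = k := by simpa using congrArg Units.val hz
  rw [← Nat.card_coe_set_eq]
  refine Eq.trans (Eq.symm ?_) hker
  refine Nat.card_congr (Equiv.ofBijective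
    (fun u ↦ ⟨(z * u.1 : Kˣ), ?_⟩) ⟨?_, ?_⟩)
  · have hu : (u.1 : Kˣ) ^ (q + 1) = 1 := u.2
    have hu' : ((u.1 : Kˣ) : K) ^ (q + 1) = 1 := by simpa using congrArg Units.val hu
    simp [mul_pow, hz', hu']
  · intro u v huv
    have h := congrArg Subtype.val huv
    simp only [Units.val_mul] at h
    exact Subtype.ext (Units.ext (mul_left_cancel₀ z.ne_zero h))
  · rintro ⟨y, hy⟩
    have hy0 : y ≠ 0 := by
      rintro rfl
      exact hk (by simpa using hy.symm)
    refine ⟨⟨z⁻¹ * Units.mk0 y hy0, ?_⟩, ?_⟩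
    · rw [MonoidHom.mem_ker, powMonoidHom_apply, mul_pow, inv_pow, inv_mul_eq_one]
      ext
      simpa [hz'] using hy.symm
    · simp

/-- The map `x ↦ x ^ q` has exactly `q` fixed points. -/
lemma ncard_frobenius_fixed (hq : 2 ≤ q) (hcard : Fintype.card K = q ^ 2) :
    {r : K | r ^ q = r}.ncard = q := by
  have hker : Nat.card (powMonoidHom (q - 1) : Kˣ →* Kˣ).ker = q - 1 := by
    rw [IsCyclic.card_powMonoidHom_ker, card_units_eq hcard, Nat.gcd_mul_left_left]
  have hset : {r : K | r ^ q = r} =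
      insert 0 ((fun u : Kˣ ↦ (u : K)) '' ((powMonoidHom (q - 1) : Kˣ →* Kˣ).ker : Set Kˣ)) := by
    ext r
    simp only [Set.mem_ofPred_eq, Set.mem_insert_iff, Set.mem_image, SetLike.mem_coe,
      MonoidHom.mem_ker, powMonoidHom_apply]
    constructor
    · intro hr
      by_cases hr0 : r = 0
      · exact Or.inl hr0
      refine Or.inr ⟨Units.mk0 r hr0, ?_, rfl⟩
      ext
      have h : r ^ (q - 1) * r = 1 * r := by
        rw [← pow_succ, Nat.sub_add_cancel (by omega), hr, one_mul]
      simpa using mul_right_cancel₀ hr0 h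
    · rintro (rfl | ⟨u, hu, rfl⟩)
      · exact zero_pow (by omega)
      · have h := congrArg (fun w : Kˣ ↦ (w * u : K)) hu
        simp only [Units.val_pow_eq_pow_val, ← pow_succ, Units.val_one, one_mul] at h
        rwa [Nat.sub_add_cancel (by omega)] at h
  rw [hset, Set.ncard_insert_of_notMem, Set.ncard_image_of_injective _ Units.val_injective,
    ← Nat.card_coe_set_eq]
  · change Nat.card (powMonoidHom (q - 1) : Kˣ →* Kˣ).ker + 1 = q
    omega
  · rintro ⟨u, -, hu⟩
    exact u.ne_zero hu

/-- Elements fixed by `x ↦ x ^ q` are squares. -/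
lemma isSquare_of_frobenius_fixed (hq : Odd q) (hchar : ringChar K ≠ 2)
    (hcard : Fintype.card K = q ^ 2) {a : K} (ha : a ^ q = a) : IsSquare a := by
  by_cases ha0 : a = 0
  · exact ⟨0, by simp [ha0]⟩
  rw [FiniteField.isSquare_iff hchar ha0, hcard]
  obtain ⟨m, rfl⟩ := hq
  have h1 : a ^ (2 * m) = 1 := by
    have h : a ^ (2 * m) * a = 1 * a := by rw [← pow_succ, ha, one_mul]
    exact mul_right_cancel₀ ha0 h
  have h2 : (2 * m + 1) ^ 2 / 2 = 2 * m * (m + 1) := by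
    have : (2 * m + 1) ^ 2 = 2 * (2 * m * (m + 1)) + 1 := by ring
    omega
  rw [h2, pow_mul, h1, one_pow]

end FieldOfSquareOrder

/-! ### Anisotropic binary forms of Hermitian type -/

section BinaryForm

variable {K : Type} [Field K] {σ : K →+* K} {α γ d : K}

/-- The form `ᾱx̄² - αx² + γxx̄` splits as `½(d + γ) N(x̄ - tx)`, when `d² = γ² + 4N(α)`. -/
lemma binaryForm_eq_norm (h2 : (2 : K) ≠ 0) (hα : α ≠ 0) (hσ : ∀ x, σ (σ x) = x)
    (hγ : σ γ = -γ) (hd : σ d = -d) (hdd : d ^ 2 = γ ^ 2 + 4 * (α * σ α)) (x : K) :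
    σ α * σ x ^ 2 - α * x ^ 2 + γ * (x * σ x) =
      (d + γ) / 2 * ((σ x - (d - γ) / (2 * σ α) * x) * σ (σ x - (d - γ) / (2 * σ α) * x)) := by
  have hα' : σ α ≠ 0 := by simpa using hα
  simp only [map_sub, map_mul, map_div₀, hσ, hγ, hd, map_ofNat]
  field_simp
  linear_combination (-2 * σ α * σ x ^ 2 + 2 * α * x ^ 2 + (d - γ) * x * σ x) * hdd

lemma sub_ne_zero_of_sq_eq (h2 : (2 : K) ≠ 0) (hα : α ≠ 0)
    (hdd : d ^ 2 = γ ^ 2 + 4 * (α * σ α)) : d - γ ≠ 0 := by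
  have hα' : σ α ≠ 0 := by simpa using hα
  intro h
  have h4 : (2 * 2 : K) * (α * σ α) = 0 := by linear_combination (d + γ) * h - hdd
  simp_all

lemma add_ne_zero_of_sq_eq (h2 : (2 : K) ≠ 0) (hα : α ≠ 0)
    (hdd : d ^ 2 = γ ^ 2 + 4 * (α * σ α)) : d + γ ≠ 0 := by
  have hα' : σ α ≠ 0 := by simpa using hα
  intro h
  have h4 : (2 * 2 : K) * (α * σ α) = 0 := by linear_combination (d - γ) * h - hdd
  simp_all

lemma injective_conj_sub_mul (h2 : (2 : K) ≠ 0) (hα : α ≠ 0) (hσ : ∀ x, σ (σ x) = x)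
    (hγ : σ γ = -γ) (hd : σ d = -d) (hd0 : d ≠ 0) (hdd : d ^ 2 = γ ^ 2 + 4 * (α * σ α)) :
    Function.Injective fun x : K ↦ σ x - (d - γ) / (2 * σ α) * x := by
  have hα' : σ α ≠ 0 := by simpa using hα
  intro x y hxy
  have h1 : 2 * σ α * σ (x - y) = (d - γ) * (x - y) := by
    simp only at hxy
    field_simp at hxy
    rw [map_sub]
    linear_combination hxy
  have h3 : 2 * α * (x - y) = (-d + γ) * σ (x - y) := by
    have := congrArg σ h1
    simp only [map_mul, map_sub, hσ, hd, hγ, map_ofNat] at this ⊢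
    linear_combination this
  have h5 : (2 * (d - γ) * d) * (x - y) = 0 := by
    linear_combination 2 * σ α * h3 + (-d + γ) * h1 + (x - y) * hdd
  have h6 := sub_ne_zero_of_sq_eq h2 hα hdd
  simpa [h2, h6, hd0, sub_eq_zero] using h5

lemma binaryForm_anisotropic (h2 : (2 : K) ≠ 0) (hα : α ≠ 0) (hσ : ∀ x, σ (σ x) = x)
    (hγ : σ γ = -γ) (hd : σ d = -d) (hd0 : d ≠ 0) (hdd : d ^ 2 = γ ^ 2 + 4 * (α * σ α)) {x : K}
    (hx : σ α * σ x ^ 2 - α * x ^ 2 + γ * (x * σ x) = 0) : x = 0 := by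
  rw [binaryForm_eq_norm h2 hα hσ hγ hd hdd] at hx
  have h6 := add_ne_zero_of_sq_eq h2 hα hdd
  simp only [mul_eq_zero, div_eq_zero_iff, h6, h2, or_self, false_or, map_eq_zero] at hx
  exact injective_conj_sub_mul h2 hα hσ hγ hd hd0 hdd (by simpa using hx)

/-- The zero `0` of an anisotropic form plus a nonzero linear part is not the only one. -/
lemma exists_ne_zero_binaryForm_add_linear (h2 : (2 : K) ≠ 0) (hα : α ≠ 0)
    (hσ : ∀ x, σ (σ x) = x) (hγ : σ γ = -γ) (hd : σ d = -d) (hd0 : d ≠ 0)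
    (hdd : d ^ 2 = γ ^ 2 + 4 * (α * σ α)) {w : K} (hw : w ≠ 0) :
    ∃ h : K, h ≠ 0 ∧
      σ α * σ h ^ 2 - α * h ^ 2 + γ * (h * σ h) + w * h - σ w * σ h = 0 := by
  set Q : K := σ α * σ (d / w) ^ 2 - α * (d / w) ^ 2 + γ * (d / w * σ (d / w)) with hQ
  have hw' : σ w ≠ 0 := by simpa using hw
  have hQ0 : Q ≠ 0 := fun h ↦
    div_ne_zero hd0 hw (binaryForm_anisotropic h2 hα hσ hγ hd hd0 hdd h)
  have hσQ : σ Q = -Q := by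
    simp only [hQ, map_sub, map_mul, map_add, map_pow, hσ, hγ]
    ring
  have hs : σ (-2 * d / Q) = -2 * d / Q := by
    rw [map_div₀, map_mul, hd, hσQ, map_neg, map_ofNat]
    field_simp
  refine ⟨-2 * d / Q * (d / w), by simp [h2, hd0, hQ0, hw], ?_⟩
  have key : σ α * (-2 * d / Q * σ (d / w)) ^ 2 - α * (-2 * d / Q * (d / w)) ^ 2 +
      γ * ((-2 * d / Q * (d / w)) * (-2 * d / Q * σ (d / w))) = (-2 * d / Q) ^ 2 * Q := by
    rw [hQ]
    ring
  rw [map_mul, hs, key, map_div₀, hd]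
  field_simp
  ring

variable [Fintype K] {q : ℕ}

lemma ncard_binaryForm_fiber (hq : 2 ≤ q) (hcard : Fintype.card K = q ^ 2)
    (hσq : ∀ x, σ x = x ^ q) (h2 : (2 : K) ≠ 0) (hα : α ≠ 0)
    (hσ : ∀ x, σ (σ x) = x) (hγ : σ γ = -γ) (hd : σ d = -d) (hd0 : d ≠ 0)
    (hdd : d ^ 2 = γ ^ 2 + 4 * (α * σ α)) {f : K} (hf0 : f ≠ 0) (hf : σ f = -f) :
    {x : K | σ α * σ x ^ 2 - α * x ^ 2 + γ * (x * σ x) + f = 0}.ncard = q + 1 := by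
  have hc := add_ne_zero_of_sq_eq h2 hα hdd
  have hinj := injective_conj_sub_mul h2 hα hσ hγ hd hd0 hdd
  have hk : (-2 * f / (d + γ)) ^ q = -2 * f / (d + γ) := by
    rw [← hσq, map_div₀, map_mul, map_neg, map_ofNat, hf, map_add, hd, hγ]
    rw [← neg_add, mul_neg, neg_div_neg_eq]
  refine Eq.trans ?_ (ncard_norm_fiber hq hcard (by simp [h2, hf0, hc]) hk)
  refine Eq.trans ?_ (Set.ncard_preimage_of_injective_subset_range hinj ?_)
  · congr 1
    ext x
    have hN : ∀ y, y * σ y = y ^ (q + 1) := fun y ↦ by rw [hσq, pow_succ']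
    rw [Set.mem_preimage, Set.mem_ofPred_eq, Set.mem_ofPred_eq,
      binaryForm_eq_norm h2 hα hσ hγ hd hdd, hN, eq_div_iff hc]
    generalize (σ x - (d - γ) / (2 * σ α) * x) ^ (q + 1) = N
    constructor
    · intro h
      field_simp at h
      linear_combination h
    · intro h
      field_simp
      linear_combination h
  · rw [(Finite.surjective_of_injective hinj).range_eq]
    exact Set.subset_univ _

/-- An anisotropic conic in the affine plane `AG(2, q)` has one or `q + 1` points. -/
lemma ncard_conic (hq : 2 ≤ q) (hcard : Fintype.card K = q ^ 2)
    (hσq : ∀ x, σ x = x ^ q) (h2 : (2 : K) ≠ 0) (hα : α ≠ 0)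
    (hσ : ∀ x, σ (σ x) = x) (hγ : σ γ = -γ) (hd : σ d = -d) (hd0 : d ≠ 0)
    (hdd : d ^ 2 = γ ^ 2 + 4 * (α * σ α)) (w : K) {f : K} (hf : σ f = -f) :
    {x : K | σ α * σ x ^ 2 - α * x ^ 2 + γ * (x * σ x) + w * x - σ w * σ x + f = 0}.ncard = 1 ∨
    {x : K | σ α * σ x ^ 2 - α * x ^ 2 + γ * (x * σ x) + w * x - σ w * σ x + f = 0}.ncard =
      q + 1 := by
  obtain ⟨z, hz⟩ : ∃ z, w - 2 * α * z + γ * σ z = 0 := by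
    refine ⟨(2 * σ α * w + γ * σ w) / d ^ 2, ?_⟩
    simp only [map_div₀, map_add, map_mul, map_ofNat, map_pow, hσ, hγ, hd, neg_sq]
    field_simp
    linear_combination w * hdd
  have hz' : σ w - 2 * σ α * σ z - γ * z = 0 := by
    have := congrArg σ hz
    simp only [map_sub, map_add, map_mul, map_ofNat, hσ, hγ, map_zero] at this
    linear_combination this
  set f' := σ α * σ z ^ 2 - α * z ^ 2 + γ * (z * σ z) + w * z - σ w * σ z + f with hf'
  have hσf' : σ f' = -f' := by
    simp only [hf', map_sub, map_add, map_mul, map_pow, hσ, hγ, hf]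
    ring
  have himg : {x : K | σ α * σ x ^ 2 - α * x ^ 2 + γ * (x * σ x) + w * x - σ w * σ x + f = 0} =
      (fun h ↦ z + h) '' {x : K | σ α * σ x ^ 2 - α * x ^ 2 + γ * (x * σ x) + f' = 0} := by
    ext x
    have : σ α * σ x ^ 2 - α * x ^ 2 + γ * (x * σ x) + w * x - σ w * σ x + f =
        σ α * σ (-z + x) ^ 2 - α * (-z + x) ^ 2 + γ * ((-z + x) * σ (-z + x)) + f' := by
      rw [hf', map_add, map_neg]
      linear_combination (x - z) * hz - (σ x - σ z) * hz'
    simp only [Set.image_add_left, Set.mem_preimage, Set.mem_ofPred_eq, this]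
  rw [himg, Set.ncard_image_of_injective _ (add_right_injective z)]
  by_cases hf0 : f' = 0
  · left
    rw [Set.ncard_eq_one]
    refine ⟨0, Set.eq_singleton_iff_unique_mem.2 ⟨by simp [hf0], fun x hx ↦ ?_⟩⟩
    exact binaryForm_anisotropic h2 hα hσ hγ hd hd0 hdd (by simpa [hf0] using hx)
  · right
    exact ncard_binaryForm_fiber hq hcard hσq h2 hα hσ hγ hd hd0 hdd hf0 hσf'

end BinaryForm

/-! ### Points and lines of the plane -/

section Plane

variable {K : Type} [Field K]

/-- The affine point `[x, y, 1]`. -/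
abbrev affinePt (x y : K) : Pt K := Projectivization.mk K ![x, y, 1] (vec1_ne_zero _ _)

variable (K) in
/-- The point `[0, 1, 0]`. -/
abbrev ptInf : Pt K := Projectivization.mk K ![0, 1, 0] vecInf_ne_zero

lemma mk_submodule_le_iff {v : Fin 3 → K} (hv : v ≠ 0) {W : Submodule K (Fin 3 → K)} :
    (Projectivization.mk K v hv).submodule ≤ W ↔ v ∈ W := by
  rw [submodule_mk, Submodule.span_singleton_le_iff_mem]

lemma affinePt_inj {x y x' y' : K} : affinePt x y = affinePt x' y' ↔ x = x' ∧ y = y' := by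
  constructor
  · intro h
    obtain ⟨a, ha⟩ := (mk_eq_mk_iff' K _ _ _ _).1 h
    have h0 := congrFun ha 0
    have h1 := congrFun ha 1
    have h2 := congrFun ha 2
    simp only [Pi.smul_apply, smul_eq_mul, Matrix.cons_val] at h0 h1 h2
    rw [mul_one] at h2
    subst h2
    exact ⟨by simpa using h0.symm, by simpa using h1.symm⟩
  · rintro ⟨rfl, rfl⟩
    rfl

lemma affinePt_ne_ptInf (x y : K) : affinePt x y ≠ ptInf K := by
  intro h
  obtain ⟨a, ha⟩ := (mk_eq_mk_iff' K _ _ _ _).1 h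
  simpa using congrFun ha 2

lemma mem_unital_iff {q : ℕ} {α β : K} {P : Pt K} :
    P ∈ unital K q α β ↔ P = ptInf K ∨ ∃ x y : K, P = affinePt x y ∧
      (y - (α * x ^ 2 + β * x ^ (q + 1))) ^ q = y - (α * x ^ 2 + β * x ^ (q + 1)) := by
  constructor
  · rintro (⟨x, r, hr, rfl⟩ | h)
    · refine Or.inr ⟨x, _, rfl, ?_⟩
      rwa [add_sub_cancel_left]
    · exact Or.inl h
  · rintro (h | ⟨x, y, rfl, h⟩)
    · exact Or.inr h
    · refine Or.inl ⟨x, _, h, ?_⟩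
      rw [affinePt_inj]
      exact ⟨rfl, by ring⟩

lemma ptInf_mem_unital {q : ℕ} {α β : K} : ptInf K ∈ unital K q α β :=
  mem_unital_iff.2 (Or.inl rfl)

lemma affinePt_mem_unital_iff {q : ℕ} {α β x y : K} :
    affinePt x y ∈ unital K q α β ↔
      (y - (α * x ^ 2 + β * x ^ (q + 1))) ^ q = y - (α * x ^ 2 + β * x ^ (q + 1)) := by
  rw [mem_unital_iff]
  constructor
  · rintro (h | ⟨x', y', h, h'⟩)
    · exact absurd h (affinePt_ne_ptInf x y)
    · obtain ⟨rfl, rfl⟩ := affinePt_inj.1 h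
      exact h'
  · exact fun h ↦ Or.inr ⟨x, y, rfl, h⟩

/-- A plane of `K³` is given by a linear equation. -/
lemma exists_equation {W : Submodule K (Fin 3 → K)} (hW : Module.finrank K W = 2) :
    ∃ a b c : K, ¬ (a = 0 ∧ b = 0 ∧ c = 0) ∧ ∀ v, v ∈ W ↔ a * v 0 + b * v 1 + c * v 2 = 0 := by
  have hlt : W < ⊤ := by
    rw [lt_top_iff_ne_top]
    rintro rfl
    simp at hW
  obtain ⟨f, hf, hle⟩ := Submodule.exists_le_ker_of_lt_top W hlt
  have hker : Module.finrank K (LinearMap.ker f) = 2 := by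
    have := Module.Dual.finrank_ker_add_one_of_ne_zero hf
    simpa using this
  have heq : W = LinearMap.ker f := Submodule.eq_of_le_of_finrank_eq hle (hW.trans hker.symm)
  have hform : ∀ v, f v = f (Pi.single 0 1) * v 0 + f (Pi.single 1 1) * v 1 +
      f (Pi.single 2 1) * v 2 := by
    intro v
    conv_lhs => rw [pi_eq_sum_univ' v, Fin.sum_univ_three]
    simp [mul_comm]
  refine ⟨f (Pi.single 0 1), f (Pi.single 1 1), f (Pi.single 2 1), ?_, fun v ↦ ?_⟩
  · rintro ⟨h0, h1, h2⟩
    apply hf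
    refine LinearMap.ext fun v ↦ ?_
    simp [hform v, h0, h1, h2]
  · rw [heq, LinearMap.mem_ker, hform]

/-- The three kinds of lines of the projective plane. -/
lemma line_cases {W : Submodule K (Fin 3 → K)} (hW : Module.finrank K W = 2) :
    (∀ v, v ∈ W ↔ v 2 = 0) ∨ (∃ x₀, ∀ v, v ∈ W ↔ v 0 = x₀ * v 2) ∨
      ∃ m k, ∀ v, v ∈ W ↔ v 1 = m * v 0 + k * v 2 := by
  obtain ⟨a, b, c, habc, h⟩ := exists_equation hW
  by_cases hb : b = 0
  · by_cases ha : a = 0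
    · left
      intro v
      have hc : c ≠ 0 := fun hc ↦ habc ⟨ha, hb, hc⟩
      simp [h, ha, hb, hc]
    · right; left
      refine ⟨-c / a, fun v ↦ ?_⟩
      rw [h, hb]
      field_simp
      constructor <;> intro h <;> linear_combination h
  · right; right
    refine ⟨-a / b, -c / b, fun v ↦ ?_⟩
    rw [h]
    field_simp
    constructor <;> intro h <;> linear_combination h

lemma exists_plane {a b c : K} (h : ¬ (a = 0 ∧ b = 0 ∧ c = 0)) :
    ∃ W : Submodule K (Fin 3 → K), Module.finrank K W = 2 ∧
      ∀ v, v ∈ W ↔ a * v 0 + b * v 1 + c * v 2 = 0 := by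
  let f : (Fin 3 → K) →ₗ[K] K :=
    a • LinearMap.proj 0 + b • LinearMap.proj 1 + c • LinearMap.proj 2
  have hf : f ≠ 0 := by
    intro hf
    refine h ⟨?_, ?_, ?_⟩
    · simpa [f] using LinearMap.congr_fun hf (Pi.single 0 1)
    · simpa [f] using LinearMap.congr_fun hf (Pi.single 1 1)
    · simpa [f] using LinearMap.congr_fun hf (Pi.single 2 1)
  refine ⟨LinearMap.ker f, ?_, fun v ↦ by simp [f]⟩
  have := Module.Dual.finrank_ker_add_one_of_ne_zero hf
  simpa using this

lemma eq_of_submodule_le {A B : Pt K} (h : A.submodule ≤ B.submodule) : A = B :=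
  submodule_injective (Submodule.eq_of_le_of_finrank_eq h (by simp [finrank_submodule]))

lemma finrank_sup_of_ne {A B : Pt K} (h : A ≠ B) :
    Module.finrank K ↥(A.submodule ⊔ B.submodule) = 2 := by
  have h1 := Submodule.finrank_sup_add_finrank_inf_eq A.submodule B.submodule
  rw [finrank_submodule, finrank_submodule] at h1
  have h2 : Module.finrank K ↥(A.submodule ⊓ B.submodule) ≠ 1 := by
    intro h3
    apply h
    apply eq_of_submodule_le
    rw [← inf_eq_left]
    exact Submodule.eq_of_le_of_finrank_eq inf_le_left (by rw [h3, finrank_submodule])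
  have h3 : Module.finrank K ↥(A.submodule ⊓ B.submodule) ≤ 1 := by
    rw [← finrank_submodule A]
    exact Submodule.finrank_mono inf_le_left
  omega

/-- If there is exactly one tangent `T` at the point `A` of `U`, then `A` is a foot of
the point `P ∉ U` precisely when `P` lies on `T`. -/
lemma mem_pedal_iff {U : Set (Pt K)} {A P : Pt K} {T : Submodule K (Fin 3 → K)}
    (hA : A ∈ U) (hP : P ∉ U) (hT : Module.finrank K T = 2) (hAT : A.submodule ≤ T)
    (htan : ∀ B ∈ U, B.submodule ≤ T → B = A)
    (huniq : ∀ W : Submodule K (Fin 3 → K), Module.finrank K W = 2 → A.submodule ≤ W →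
      (∀ B ∈ U, B.submodule ≤ W → B = A) → W = T) :
    A ∈ pedal U P ↔ P.submodule ≤ T := by
  have hne : P ≠ A := by
    rintro rfl
    exact hP hA
  constructor
  · rintro ⟨-, h⟩
    rw [← huniq _ (finrank_sup_of_ne hne) le_sup_right fun B hB hBW ↦ ?_]
    · exact le_sup_left
    · have : B ∈ lineThrough P A ∩ U := ⟨hBW, hB⟩
      rwa [h] at this
  · intro h
    have hsup : P.submodule ⊔ A.submodule = T :=
      Submodule.eq_of_le_of_finrank_eq (sup_le h hAT) ((finrank_sup_of_ne hne).trans hT.symm)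
    refine ⟨hA, Set.eq_singleton_iff_unique_mem.2 ⟨⟨?_, hA⟩, ?_⟩⟩
    · exact le_sup_right (a := P.submodule)
    · rintro B ⟨hB, hBU⟩
      exact htan B hBU (hsup ▸ hB)

/-- If `K` has `q ^ 2` elements, then a two-dimensional subspace is not covered by `q + 1`
subspaces that do not contain it. -/
lemma exists_mem_notMem [Fintype K] {q : ℕ} (hq : 2 ≤ q) (hcard : Fintype.card K = q ^ 2)
    {T : Submodule K (Fin 3 → K)} (hT : Module.finrank K T = 2)
    (S : Fin (q + 1) → Submodule K (Fin 3 → K)) (hS : ∀ j, ¬ T ≤ S j) :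
    ∃ v ∈ T, ∀ j, v ∉ S j := by
  by_contra! hcon
  have hsub : (T : Set (Fin 3 → K)) ⊆ ⋃ j ∈ (Finset.univ : Finset (Fin (q + 1))),
      (↑(T ⊓ S j) : Set (Fin 3 → K)) := by
    intro v hv
    obtain ⟨j, hj⟩ := hcon v hv
    simp only [Set.mem_iUnion]
    exact ⟨j, Finset.mem_univ j, hv, hj⟩
  have hsize : ∀ W : Submodule K (Fin 3 → K),
      (W : Set (Fin 3 → K)).ncard = (q ^ 2) ^ Module.finrank K W := by
    intro W
    rw [← Nat.card_coe_set_eq, ← hcard, ← Nat.card_eq_fintype_card]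
    exact Module.natCard_eq_pow_finrank (K := K) (V := W)
  have hrank : ∀ j, Module.finrank K ↥(T ⊓ S j) ≤ 1 := by
    intro j
    have hlt : T ⊓ S j < T := inf_le_left.lt_of_ne fun h ↦ hS j (inf_eq_left.1 h)
    have := Submodule.finrank_lt_finrank_of_lt hlt
    omega
  have h1 := (Set.ncard_le_ncard hsub (Set.toFinite _)).trans (Finset.set_ncard_biUnion_le _ _)
  have h2 : ∑ j : Fin (q + 1), (↑(T ⊓ S j) : Set (Fin 3 → K)).ncard ≤
      ∑ _j : Fin (q + 1), q ^ 2 := by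
    refine Finset.sum_le_sum fun j _ ↦ ?_
    rw [hsize]
    exact (Nat.pow_le_pow_right (by positivity) (hrank j)).trans_eq (pow_one _)
  rw [hsize, hT] at h1
  have h3 := h1.trans h2
  rw [Finset.sum_const, Finset.card_univ, Fintype.card_fin, smul_eq_mul] at h3
  have h4 : q ^ 2 ≤ q + 1 := by
    refine Nat.le_of_mul_le_mul_right (c := q ^ 2) ?_ (by positivity)
    rwa [← sq]
  nlinarith

end Plane

/-! ### Lines and tangents of the unital -/

section Unital

variable {K : Type} [Field K] {q : ℕ} {α β d : K} {σ : K →+* K}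

/-- The intersection of `U` with a line `y = mx + k` is described by a binary quadratic equation. -/
lemma affinePt_mem_unital_iff_conic (hσq : ∀ x, σ x = x ^ q) (hσ : ∀ x, σ (σ x) = x)
    (m k x : K) :
    affinePt x (m * x + k) ∈ unital K q α β ↔
      σ α * σ x ^ 2 - α * x ^ 2 + (σ β - β) * (x * σ x) + m * x - σ m * σ x + (k - σ k) = 0 := by
  rw [affinePt_mem_unital_iff, ← hσq, pow_succ x q, ← hσq]
  simp only [map_sub, map_add, map_mul, map_pow, hσ]
  constructor <;> intro h <;> linear_combination -h

/-- Every line meets `U` in one or `q + 1` points. -/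
lemma ncard_line_inter_unital [Fintype K] (hq : 2 ≤ q) (hcard : Fintype.card K = q ^ 2)
    (hσq : ∀ x, σ x = x ^ q) (h2 : (2 : K) ≠ 0) (hα : α ≠ 0)
    (hσ : ∀ x, σ (σ x) = x) (hd : σ d = -d) (hd0 : d ≠ 0)
    (hdd : d ^ 2 = (σ β - β) ^ 2 + 4 * (α * σ α))
    {W : Submodule K (Fin 3 → K)} (hW : Module.finrank K W = 2) :
    ({P : Pt K | P.submodule ≤ W} ∩ unital K q α β).ncard = 1 ∨
      ({P : Pt K | P.submodule ≤ W} ∩ unital K q α β).ncard = q + 1 := by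
  rcases line_cases hW with h | ⟨x₀, h⟩ | ⟨m, k, h⟩
  · left
    rw [Set.ncard_eq_one]
    refine ⟨ptInf K, Set.eq_singleton_iff_unique_mem.2 ⟨⟨?_, ptInf_mem_unital⟩, ?_⟩⟩
    · rw [Set.mem_ofPred_eq, mk_submodule_le_iff, h]
      rfl
    · rintro P ⟨hP, hPU⟩
      rcases mem_unital_iff.1 hPU with hP' | ⟨x, y, rfl, -⟩
      · exact hP'
      · rw [Set.mem_ofPred_eq, mk_submodule_le_iff, h] at hP
        exact absurd hP one_ne_zero
  · right
    have hset : {P : Pt K | P.submodule ≤ W} ∩ unital K q α β = insert (ptInf K)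
        ((fun r ↦ affinePt x₀ (α * x₀ ^ 2 + β * x₀ ^ (q + 1) + r)) '' {r : K | r ^ q = r}) := by
      ext P
      constructor
      · rintro ⟨hP, hPU⟩
        rcases mem_unital_iff.1 hPU with hP' | ⟨x, y, rfl, hxy⟩
        · exact Or.inl hP'
        · rw [Set.mem_ofPred_eq, mk_submodule_le_iff, h] at hP
          obtain rfl : x = x₀ := by simpa using hP
          refine Or.inr ⟨_, hxy, ?_⟩
          simp only [add_sub_cancel]
      · rintro (rfl | ⟨r, hr, rfl⟩)
        · refine ⟨?_, ptInf_mem_unital⟩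
          rw [Set.mem_ofPred_eq, mk_submodule_le_iff, h]
          simp
        · refine ⟨?_, ?_⟩
          · rw [Set.mem_ofPred_eq, mk_submodule_le_iff, h]
            simp
          · simp only
            rw [affinePt_mem_unital_iff, add_sub_cancel_left]
            exact hr
    rw [hset, Set.ncard_insert_of_notMem, Set.ncard_image_of_injective,
      ncard_frobenius_fixed hq hcard]
    · intro r s hrs
      exact add_left_cancel (affinePt_inj.1 hrs).2
    · rintro ⟨r, -, hr⟩
      exact affinePt_ne_ptInf _ _ hr
  · have hset : {P : Pt K | P.submodule ≤ W} ∩ unital K q α β = (fun x ↦ affinePt x (m * x + k)) ''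
        {x : K | σ α * σ x ^ 2 - α * x ^ 2 + (σ β - β) * (x * σ x) + m * x - σ m * σ x +
          (k - σ k) = 0} := by
      ext P
      constructor
      · rintro ⟨hP, hPU⟩
        rcases mem_unital_iff.1 hPU with rfl | ⟨x, y, rfl, -⟩
        · rw [Set.mem_ofPred_eq, mk_submodule_le_iff, h] at hP
          simp at hP
        · rw [Set.mem_ofPred_eq, mk_submodule_le_iff, h] at hP
          obtain rfl : y = m * x + k := by simpa using hP
          exact ⟨x, (affinePt_mem_unital_iff_conic hσq hσ m k x).1 hPU, rfl⟩
      · rintro ⟨x, hx, rfl⟩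
        refine ⟨?_, (affinePt_mem_unital_iff_conic hσq hσ m k x).2 hx⟩
        rw [Set.mem_ofPred_eq, mk_submodule_le_iff, h]
        simp
    rw [hset, Set.ncard_image_of_injective _ fun x y hxy ↦ (affinePt_inj.1 hxy).1]
    refine ncard_conic hq hcard hσq h2 hα hσ ?_ hd hd0 hdd m ?_
    · simp [hσ]
    · simp [hσ]

/-- There is exactly one tangent at each point of `U`. -/
lemma exists_unique_tangent (hq : 2 ≤ q) (hσq : ∀ x, σ x = x ^ q) (h2 : (2 : K) ≠ 0) (hα : α ≠ 0)
    (hσ : ∀ x, σ (σ x) = x) (hd : σ d = -d) (hd0 : d ≠ 0)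
    (hdd : d ^ 2 = (σ β - β) ^ 2 + 4 * (α * σ α)) {A : Pt K} (hA : A ∈ unital K q α β) :
    ∃ T : Submodule K (Fin 3 → K), Module.finrank K T = 2 ∧ A.submodule ≤ T ∧
      (∀ B ∈ unital K q α β, B.submodule ≤ T → B = A) ∧
      ∀ W : Submodule K (Fin 3 → K), Module.finrank K W = 2 → A.submodule ≤ W →
        (∀ B ∈ unital K q α β, B.submodule ≤ W → B = A) → W = T := by
  rcases mem_unital_iff.1 hA with rfl | ⟨x₀, y₀, rfl, -⟩
  · obtain ⟨T, hT, hmem⟩ := exists_plane (a := (0 : K)) (b := 0) (c := 1) (by simp)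
    simp only [zero_mul, zero_add, one_mul] at hmem
    refine ⟨T, hT, ?_, ?_, ?_⟩
    · rw [mk_submodule_le_iff, hmem]
      rfl
    · intro B hB hBT
      rcases mem_unital_iff.1 hB with hB' | ⟨x, y, rfl, -⟩
      · exact hB'
      · rw [mk_submodule_le_iff, hmem] at hBT
        exact absurd hBT one_ne_zero
    · intro W hW hAW htan
      rcases line_cases hW with h | ⟨x₀, h⟩ | ⟨m, k, h⟩
      · ext v
        rw [h, hmem]
      · refine absurd (htan (affinePt x₀ (α * x₀ ^ 2 + β * x₀ ^ (q + 1))) ?_ ?_)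
          (affinePt_ne_ptInf _ _)
        · rw [affinePt_mem_unital_iff, sub_self, zero_pow (by omega)]
        · rw [mk_submodule_le_iff, h]
          simp
      · rw [mk_submodule_le_iff, h] at hAW
        simp at hAW
  · have hσγ : σ (σ β - β) = -(σ β - β) := by simp [hσ]
    obtain ⟨m₀, hm₀⟩ : ∃ m₀, m₀ = 2 * α * x₀ - (σ β - β) * σ x₀ := ⟨_, rfl⟩
    obtain ⟨k₀, hk₀⟩ : ∃ k₀, y₀ = m₀ * x₀ + k₀ := ⟨y₀ - m₀ * x₀, by ring⟩
    have hσm₀ : σ m₀ = 2 * σ α * σ x₀ + (σ β - β) * x₀ := by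
      rw [hm₀]
      simp only [map_sub, map_mul, map_ofNat, hσ]
      ring
    obtain ⟨T, hT, hmem⟩ := exists_plane (a := m₀) (b := -1) (c := k₀) (by simp)
    have hmem' : ∀ v, v ∈ T ↔ v 1 = m₀ * v 0 + k₀ * v 2 := by
      intro v
      rw [hmem]
      constructor <;> intro h <;> linear_combination -h
    refine ⟨T, hT, ?_, ?_, ?_⟩
    · rw [mk_submodule_le_iff, hmem']
      simp [hk₀]
    · intro B hB hBT
      rcases mem_unital_iff.1 hB with rfl | ⟨x, y, rfl, -⟩
      · rw [mk_submodule_le_iff, hmem'] at hBT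
        simp at hBT
      · rw [mk_submodule_le_iff, hmem'] at hBT
        obtain rfl : y = m₀ * x + k₀ := by simpa using hBT
        rw [hk₀] at hA
        rw [affinePt_mem_unital_iff_conic hσq hσ] at hA hB
        have hx : x - x₀ = 0 := by
          refine binaryForm_anisotropic h2 hα hσ hσγ hd hd0 hdd ?_
          rw [map_sub]
          linear_combination hB - hA - (x - x₀) * hm₀ + (σ x - σ x₀) * hσm₀
        obtain rfl := sub_eq_zero.1 hx
        rw [hk₀]
    · intro W hW hAW htan
      rcases line_cases hW with h | ⟨x₁, h⟩ | ⟨m, k, h⟩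
      · rw [mk_submodule_le_iff, h] at hAW
        exact absurd hAW one_ne_zero
      · refine absurd (htan (ptInf K) ptInf_mem_unital ?_).symm (affinePt_ne_ptInf _ _)
        rw [mk_submodule_le_iff, h]
        simp
      · rw [mk_submodule_le_iff, h] at hAW
        have hy : y₀ = m * x₀ + k := by simpa using hAW
        by_cases hw : m - m₀ = 0
        · obtain rfl := sub_eq_zero.1 hw
          obtain rfl : k = k₀ := add_left_cancel (hy.symm.trans hk₀)
          ext v
          rw [h, hmem']
        · exfalso
          obtain ⟨t, ht0, ht⟩ :=
            exists_ne_zero_binaryForm_add_linear h2 hα hσ hσγ hd hd0 hdd hw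
          rw [hy, affinePt_mem_unital_iff_conic hσq hσ] at hA
          have := htan (affinePt (x₀ + t) (m * (x₀ + t) + k)) ?_ ?_
          · exact ht0 (by simpa using (affinePt_inj.1 this).1)
          · rw [affinePt_mem_unital_iff_conic hσq hσ, map_add]
            rw [map_sub] at ht
            linear_combination hA + ht + t * hm₀ - σ t * hσm₀
          · rw [mk_submodule_le_iff, h]
            simp

/-- The conjugation of `K` over its subfield of order `q`, with a square root `d` of the
discriminant of the unital. -/
lemma exists_conjugation [Fintype K] {p n : ℕ} (hp : p.Prime) (hpodd : Odd p) (hq : q = p ^ n)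
    (hcard : Fintype.card K = q ^ 2)
    (hns : ¬ ∃ s : K, s ^ q = s ∧ 4 * α ^ (q + 1) + (β ^ q - β) ^ 2 = s ^ 2) :
    ∃ (σ : K →+* K) (d : K), (∀ x, σ x = x ^ q) ∧ (∀ x, σ (σ x) = x) ∧ (2 : K) ≠ 0 ∧
      σ d = -d ∧ d ≠ 0 ∧ d ^ 2 = (σ β - β) ^ 2 + 4 * (α * σ α) := by
  have hFp : Fact p.Prime := ⟨hp⟩
  have hchar : CharP K p := by
    refine charP_of_card_eq_prime_pow (f := n * 2) ?_
    rw [hcard, hq, pow_mul]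
  have hexp : ExpChar K p := ExpChar.prime hp
  have hp2 : p ≠ 2 := by
    rintro rfl
    exact absurd hpodd (by decide)
  have hring : ringChar K ≠ 2 := by rwa [ringChar.eq K p]
  have h2 : (2 : K) ≠ 0 := Ring.two_ne_zero hring
  obtain ⟨σ, hσq⟩ : ∃ σ : K →+* K, ∀ x, σ x = x ^ q :=
    ⟨iterateFrobenius K p n, fun x ↦ by rw [iterateFrobenius_def, hq]⟩
  have hσ : ∀ x, σ (σ x) = x := by
    intro x
    rw [hσq, hσq, ← pow_mul, ← sq, ← hcard, FiniteField.pow_card]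
  obtain ⟨d, hd⟩ : IsSquare ((σ β - β) ^ 2 + 4 * (α * σ α)) := by
    refine isSquare_of_frobenius_fixed (q := q) (hq ▸ hpodd.pow) hring hcard ?_
    rw [← hσq]
    simp only [map_add, map_sub, map_mul, map_pow, map_ofNat, hσ]
    ring
  have hns' : ∀ s : K, σ s = s → s ^ 2 ≠ (σ β - β) ^ 2 + 4 * (α * σ α) := by
    intro s hs h
    refine hns ⟨s, by rw [← hσq, hs], ?_⟩
    rw [h, pow_succ', hσq, hσq]
    ring
  have hσd : σ d ^ 2 = d ^ 2 := by
    rw [← map_pow, sq d, ← hd]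
    simp only [map_add, map_sub, map_mul, map_pow, map_ofNat, hσ]
    ring
  refine ⟨σ, d, hσq, hσ, h2, ?_, ?_, by rw [hd, sq d]⟩
  · exact (sq_eq_sq_iff_eq_or_eq_neg.1 hσd).resolve_left fun h ↦ hns' d h (by rw [hd, sq d])
  · rintro rfl
    exact hns' 0 (map_zero σ) (by rw [hd, sq])

end Unital

theorem stmt_4 {K : Type} [Field K] [Fintype K] (p n q : ℕ)
    (hp : p.Prime) (hpodd : Odd p) (hn : 0 < n) (hq : q = p ^ n)
    (hcard : Fintype.card K = q ^ 2)
    (α β : K) (hα : α ≠ 0)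
    (hns : ¬ ∃ s : K, s ^ q = s ∧ 4 * α ^ (q + 1) + (β ^ q - β) ^ 2 = s ^ 2)
    (l : Set (Pt K)) (hl : isLine l)
    (hnt : ¬ ∃ A : Pt K, l ∩ unital K q α β = {A}) :
    ∃ P A : Fin (q + 1) → Pt K,
      (∀ i, P i ∉ unital K q α β) ∧
      (∀ i j, i ≠ j → pedal (unital K q α β) (P i) ≠ pedal (unital K q α β) (P j)) ∧
      (∀ i, pedal (unital K q α β) (P i) ∩ l = {A i}) ∧
      Function.Injective A ∧
      Set.range A = l ∩ unital K q α β := by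
  obtain ⟨σ, d, hσq, hσ, h2, hd, hd0, hdd⟩ := exists_conjugation hp hpodd hq hcard hns
  have hq2 : 2 ≤ q := hq ▸ hp.two_le.trans (Nat.le_self_pow hn.ne' p)
  obtain ⟨W, hW, rfl⟩ := hl
  have hncard := (ncard_line_inter_unital hq2 hcard hσq h2 hα hσ hd hd0 hdd hW).resolve_left
    fun h ↦ hnt (Set.ncard_eq_one.1 h)
  set L : Set (Pt K) := {P | P.submodule ≤ W} with hL
  have hLfin : (L ∩ unital K q α β).Finite := Set.finite_of_ncard_ne_zero (by omega)
  have : Finite ↥(L ∩ unital K q α β) := hLfin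
  let e : Fin (q + 1) ≃ ↥(L ∩ unital K q α β) :=
    (finCongr (hncard.symm.trans (Nat.card_coe_set_eq _).symm)).trans (Finite.equivFin _).symm
  have hAU : ∀ i, (e i : Pt K) ∈ unital K q α β := fun i ↦ (e i).2.2
  choose T hT hAT htan huniq using fun i ↦
    exists_unique_tangent hq2 hσq h2 hα hσ hd hd0 hdd (hAU i)
  have hinj : Function.Injective fun i ↦ (e i : Pt K) :=
    Subtype.val_injective.comp e.injective
  have hP : ∀ i, ∃ P : Pt K, P ∉ unital K q α β ∧ P.submodule ≤ T i ∧
      ∀ j, P.submodule ≤ T j → j = i := by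
    intro i
    obtain ⟨v, hv, hvS⟩ := exists_mem_notMem hq2 hcard (hT i)
      (fun j ↦ if j = i then (e i : Pt K).submodule else T j) (by
        intro j hj
        split_ifs at hj with hji
        · have := Submodule.finrank_mono hj
          rw [hT i, finrank_submodule] at this
          omega
        · have hTij : T i = T j := Submodule.eq_of_le_of_finrank_eq hj ((hT i).trans (hT j).symm)
          exact hji (hinj (htan i (e j) (hAU j) (hTij ▸ hAT j))))
    have hv0 : v ≠ 0 := by
      rintro rfl
      exact hvS i (Submodule.zero_mem _)
    refine ⟨Projectivization.mk K v hv0, ?_, mk_submodule_le_iff hv0 |>.2 hv, ?_⟩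
    · intro hU
      have hPA := htan i _ hU (mk_submodule_le_iff hv0 |>.2 hv)
      have h := hvS i
      rw [if_pos rfl, ← mk_submodule_le_iff hv0, hPA] at h
      exact h le_rfl
    · intro j hj
      by_contra hji
      have h := hvS j
      rw [if_neg hji, ← mk_submodule_le_iff hv0] at h
      exact h hj
  choose P hPU hPT hPj using hP
  have hped : ∀ i, pedal (unital K q α β) (P i) ∩ L = {(e i : Pt K)} := by
    intro i
    ext B
    constructor
    · rintro ⟨hB, hBL⟩
      obtain ⟨j, hj⟩ := e.surjective ⟨B, hBL, hB.1⟩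
      have hBj : (e j : Pt K) = B := congrArg Subtype.val hj
      rw [← hBj, mem_pedal_iff (hAU j) (hPU i) (hT j) (hAT j) (htan j) (huniq j)] at hB
      rw [← hBj, hPj i j hB]
      rfl
    · rintro rfl
      exact ⟨(mem_pedal_iff (hAU i) (hPU i) (hT i) (hAT i) (htan i) (huniq i)).2 (hPT i),
        (e i).2.1⟩
  refine ⟨P, fun i ↦ e i, hPU, fun i j hij h ↦ ?_, hped, hinj, ?_⟩
  · refine hij (hinj (Set.singleton_injective ?_))
    simp only [← hped, h]
  · rw [Set.range_comp' Subtype.val e, e.range_eq_univ, Set.image_univ, Subtype.range_coe]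
end
end

section
/- For every x ∈ K and r ∈ GF(q), the line ℓ = { [u,v,w] ∈ PG(2,q²) : u·(−2αx + (β̄−β)x̄) + v + w·(αx² − β̄N(x) − r) = 0 } is the tangent line to U at the point [x, αx² + βN(x) + r, 1]; that is, ℓ ∩ U = { [x, αx² + βN(x) + r, 1] }. -/
noncomputable section
open Projectivization
open scoped LinearAlgebra.Projectivization

/-- A linear form `(a, 1, c)` vanishes on the representative of `[v]` iff it vanishes on `v`. -/
lemma linear_form_rep_eq_zero_iff {K : Type} [Field K] (v : Fin 3 → K) (hv : v ≠ 0) (a c : K) :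
    (Projectivization.mk K v hv).rep 0 * a + (Projectivization.mk K v hv).rep 1 +
        (Projectivization.mk K v hv).rep 2 * c = 0 ↔ v 0 * a + v 1 + v 2 * c = 0 := by
  obtain ⟨t, ht⟩ := Projectivization.exists_smul_eq_mk_rep K v hv
  rw [← ht]
  simp only [Pi.smul_apply, Units.smul_def, smul_eq_mul]
  rw [show (t : K) * v 0 * a + t * v 1 + t * v 2 * c = t * (v 0 * a + v 1 + v 2 * c) by
    ring]
  simp

/-- If the discriminant `4N(α) + (β̄ - β)²` is not the square of an element fixed by the involution
`σ`, then `αd² + βN(d)` is fixed by `σ` only for `d = 0`. -/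
lemma eq_zero_of_map_form_eq {K : Type} [Field K] (σ : K →+* K) (hσ : ∀ z, σ (σ z) = z)
    {α β : K} (hns : ¬ ∃ s : K, σ s = s ∧ 4 * (σ α * α) + (σ β - β) ^ 2 = s ^ 2) {d : K}
    (hd : σ (α * d ^ 2 + β * (σ d * d)) = α * d ^ 2 + β * (σ d * d)) : d = 0 := by
  by_contra h0
  have h1 : σ d ≠ 0 := (map_ne_zero σ).2 h0
  simp only [map_add, map_mul, map_pow, hσ] at hd
  refine hns ⟨(α * d ^ 2 + σ α * σ d ^ 2) / (σ d * d), ?_, ?_⟩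
  · simp only [map_div₀, map_add, map_mul, map_pow, hσ]
    rw [mul_comm d, add_comm]
  · rw [div_pow, eq_div_iff (pow_ne_zero 2 (mul_ne_zero h1 h0))]
    linear_combination ((σ β - β) * (σ d * d) - σ α * σ d ^ 2 + α * d ^ 2) * hd

theorem stmt_5 {K : Type} [Field K] [Fintype K] (p n q : ℕ)
    (hp : p.Prime) (hpodd : Odd p) (hn : 0 < n) (hq : q = p ^ n)
    (hcard : Fintype.card K = q ^ 2)
    (α β : K) (hα : α ≠ 0)
    (hns : ¬ ∃ s : K, s ^ q = s ∧ 4 * α ^ (q + 1) + (β ^ q - β) ^ 2 = s ^ 2)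
    (x r : K) (hr : r ^ q = r) :
    {P : Pt K | P.rep 0 * (-(2 * α * x) + (β ^ q - β) * x ^ q) + P.rep 1 +
        P.rep 2 * (α * x ^ 2 - β ^ q * x ^ (q + 1) - r) = 0} ∩ unital K q α β =
      {Projectivization.mk K ![x, α * x ^ 2 + β * x ^ (q + 1) + r, 1] (vec1_ne_zero _ _)} := by
  have : Fact p.Prime := ⟨hp⟩
  have : CharP K p := charP_of_card_eq_prime_pow (f := n * 2) (by rw [hcard, hq, pow_mul])
  let σ : K →+* K := iterateFrobenius K p n
  have σ_def (z : K) : z ^ q = σ z := by rw [hq]; rfl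
  have hσ (z : K) : σ (σ z) = z := by
    rw [← σ_def, ← σ_def, ← pow_mul, ← sq, ← hcard, FiniteField.pow_card]
  clear_value σ
  simp only [pow_succ _ q, σ_def] at hns hr
  ext P
  simp only [Set.mem_inter_iff, Set.mem_ofPred_eq, Set.mem_singleton_iff, unital]
  constructor
  · rintro ⟨hP, ⟨y, s, hs, rfl⟩ | rfl⟩
    · rw [linear_form_rep_eq_zero_iff] at hP
      simp [pow_succ _ q, σ_def] at hP hs
      obtain ⟨d, rfl⟩ : ∃ d, y = x + d := ⟨y - x, by ring⟩
      rw [map_add] at hP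
      have key : α * d ^ 2 + β * (σ d * d) = r - s - (σ β * d * σ x + β * x * σ d) := by
        linear_combination hP
      have hd : d = 0 := by
        refine eq_zero_of_map_form_eq σ hσ hns ?_
        rw [key]
        simp only [map_add, map_sub, map_mul, hσ, hr, hs]
        ring
      subst hd
      have hsr : s = r := by
        simp at key
        linear_combination key
      subst hsr
      simp
    · rw [linear_form_rep_eq_zero_iff] at hP
      simp at hP
  · rintro rfl
    refine ⟨?_, Or.inl ⟨x, r, (σ_def r).trans hr, rfl⟩⟩
    simp [linear_form_rep_eq_zero_iff, pow_succ _ q, σ_def]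
    ring
end
end

section
/- The pedal of P_λ is exactly τ_{P_λ}(U) = { Q_x : x ∈ T_λ }, where T_λ = { x ∈ K : 2e + αx² − ᾱx̄² + (β−β̄)N(x) = 0 } and Q_x = [x, T(αx²) − e, 1]. -/
noncomputable section
open Projectivization
open scoped LinearAlgebra.Projectivization

/-- The set `T_λ = {x ∈ K : 2e + αx² − ᾱx̄² + (β−β̄)N(x) = 0}` (with `x̄ = x^q`, `N(x) = x^(q+1)`). -/
def Tlam (K : Type) [Field K] (q : ℕ) (α β e : K) : Set K :=
  {x | 2 * e + α * x ^ 2 - α ^ q * (x ^ q) ^ 2 + (β - β ^ q) * x ^ (q + 1) = 0}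

/-- The point `Q_x = [x, T(αx²) − e, 1]`, where `T(y) = y + y^q`. -/
def Qpt (K : Type) [Field K] (q : ℕ) (α e : K) (x : K) : Pt K :=
  Projectivization.mk K ![x, (α * x ^ 2 + (α * x ^ 2) ^ q) - e, 1] (vec1_ne_zero _ _)

lemma mem_lineThrough_mk_iff {K : Type} [Field K] {u v w : Fin 3 → K} (hu : u ≠ 0) (hv : v ≠ 0)
    (hw : w ≠ 0) :
    Projectivization.mk K w hw ∈
        lineThrough (Projectivization.mk K u hu) (Projectivization.mk K v hv) ↔
      ∃ a b : K, a • u + b • v = w := by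
  simp only [lineThrough, Set.mem_ofPred_eq, Projectivization.submodule_mk,
    ← Submodule.span_insert, Submodule.span_singleton_le_iff_mem, ← Submodule.mem_span_pair]

lemma mk_affine_eq_iff {K : Type} [Field K] {x y x' y' : K} :
    Projectivization.mk K ![x, y, 1] (vec1_ne_zero _ _) =
      Projectivization.mk K ![x', y', 1] (vec1_ne_zero _ _) ↔ x = x' ∧ y = y' := by
  rw [Projectivization.mk_eq_mk_iff']
  constructor
  · rintro ⟨a, ha⟩
    have h0 := congrFun ha 0
    have h1 := congrFun ha 1
    have h2 := congrFun ha 2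
    simp at h0 h1 h2
    subst h2
    simp at h0 h1
    exact ⟨h0.symm, h1.symm⟩
  · rintro ⟨rfl, rfl⟩
    exact ⟨1, one_smul _ _⟩

lemma mk_affine_ne_mk_infinity {K : Type} [Field K] {x y : K} :
    Projectivization.mk K ![x, y, 1] (vec1_ne_zero _ _) ≠
      Projectivization.mk K ![0, 1, 0] vecInf_ne_zero := by
  rw [Ne, Projectivization.mk_eq_mk_iff']
  rintro ⟨a, ha⟩
  have h2 := congrFun ha 2
  simp at h2

lemma mk_affine_mem_lineThrough_iff {K : Type} [Field K] {e x y a b : K} :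
    Projectivization.mk K ![a, b, 1] (vec1_ne_zero _ _) ∈
        lineThrough (Projectivization.mk K ![0, e, 1] (vec1_ne_zero _ _))
          (Projectivization.mk K ![x, y, 1] (vec1_ne_zero _ _)) ↔
      ∃ t : K, a = t * x ∧ b = e + t * (y - e) := by
  rw [mem_lineThrough_mk_iff]
  constructor
  · rintro ⟨s, t, h⟩
    have h0 := congrFun h 0
    have h1 := congrFun h 1
    have h2 := congrFun h 2
    simp at h0 h1 h2
    exact ⟨t, h0.symm, by linear_combination -h1 + e * h2⟩
  · rintro ⟨t, rfl, rfl⟩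
    refine ⟨1 - t, t, ?_⟩
    ext i
    fin_cases i
    · simp
    · simp
      ring
    · simp

lemma mk_infinity_mem_lineThrough_iff {K : Type} [Field K] {e x y : K} (hye : y ≠ e) :
    Projectivization.mk K ![0, 1, 0] vecInf_ne_zero ∈
        lineThrough (Projectivization.mk K ![0, e, 1] (vec1_ne_zero _ _))
          (Projectivization.mk K ![x, y, 1] (vec1_ne_zero _ _)) ↔ x = 0 := by
  rw [mem_lineThrough_mk_iff]
  constructor
  · rintro ⟨s, t, h⟩
    have h0 := congrFun h 0
    have h1 := congrFun h 1
    have h2 := congrFun h 2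
    simp at h0 h1 h2
    rcases h0 with rfl | h0
    · simp at h2
      subst h2
      simp at h1
    · exact h0
  · rintro rfl
    have hne := sub_ne_zero.mpr hye
    refine ⟨-(y - e)⁻¹, (y - e)⁻¹, ?_⟩
    ext i
    fin_cases i
    · simp
    · simp
      field_simp
      ring
    · simp

lemma anisotropic_of_not_square {K : Type} [Field K] (σ : K →+* K) (hσ : ∀ x, σ (σ x) = x)
    {α β : K} (hns : ¬ ∃ s : K, σ s = s ∧ 4 * (σ α * α) + (σ β - β) ^ 2 = s ^ 2)
    {z : K} (hz : z ≠ 0) : α * z ^ 2 - σ α * σ z ^ 2 + (β - σ β) * (σ z * z) ≠ 0 := by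
  intro h
  have hz' : σ z ≠ 0 := (map_ne_zero σ).mpr hz
  refine hns ⟨(2 * (α * z ^ 2) + (β - σ β) * (σ z * z)) / (σ z * z), ?_, ?_⟩
  · simp only [map_div₀, map_add, map_mul, map_sub, map_pow, hσ, map_ofNat]
    field_simp
    linear_combination -2 * h
  · field_simp
    linear_combination -4 * α * h

/-- If the form `s ↦ s w - σ(s w)`, linear over the fixed field of `σ`, agrees with the anisotropic
quadratic form only at `s = 0`, then `w = 0`: otherwise rescaling `s` yields another solution. -/
lemma linear_part_eq_zero {K : Type} [Field K] (σ : K →+* K) (hσ : ∀ x, σ (σ x) = x)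
    {α β e x w : K} (h2 : (2 : K) ≠ 0) (he : e ≠ 0) (hσe : σ e = -e)
    (haniso : ∀ z : K, z ≠ 0 → α * z ^ 2 - σ α * σ z ^ 2 + (β - σ β) * (σ z * z) ≠ 0)
    (hx : x ≠ 0)
    (huniq : ∀ s : K, s * w - σ s * σ w =
      α * (s * x) ^ 2 - σ α * σ (s * x) ^ 2 + (β - σ β) * (σ (s * x) * (s * x)) → s = 0) :
    w = 0 := by
  have hL : ∀ s : K, s * w - σ s * σ w = 0 := by
    intro s
    by_contra hs
    have hs0 : s ≠ 0 := by
      rintro rfl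
      simp at hs
    have hG := haniso (s * x) (mul_ne_zero hs0 hx)
    set G := α * (s * x) ^ 2 - σ α * σ (s * x) ^ 2 + (β - σ β) * (σ (s * x) * (s * x)) with hGdef
    set c := (s * w - σ s * σ w) / G with hc
    have hσG : σ G = -G := by
      simp only [hGdef, map_add, map_mul, map_sub, map_pow, hσ]
      ring
    have hσc : σ c = c := by
      rw [hc, map_div₀, hσG]
      simp only [map_mul, map_sub, hσ]
      rw [div_neg, ← neg_div]
      ring
    have hcG : c * G = s * w - σ s * σ w := div_mul_cancel₀ _ hG
    have := huniq (c * s) (by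
      simp only [map_mul, hσc] at hGdef ⊢
      linear_combination -c * hcG + c ^ 2 * hGdef)
    exact mul_ne_zero (div_ne_zero hs hG) hs0 this
  have h1 := hL 1
  have h3 := hL e
  simp only [map_one, hσe] at h1 h3
  have : 2 * e * w = 0 := by linear_combination h3 + e * h1
  simpa [h2, he] using this

theorem stmt_6 {K : Type} [Field K] [Fintype K] (p n q : ℕ)
    (hp : p.Prime) (hpodd : Odd p) (hn : 0 < n) (hq : q = p ^ n)
    (hcard : Fintype.card K = q ^ 2)
    (α β : K) (hα : α ≠ 0)
    (hns : ¬ ∃ s : K, s ^ q = s ∧ 4 * α ^ (q + 1) + (β ^ q - β) ^ 2 = s ^ 2)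
    (e : K) (he : e ≠ 0) (heq : e ^ q = -e) :
    pedal (unital K q α β) (Projectivization.mk K ![0, e, 1] (vec1_ne_zero _ _)) =
      Qpt K q α e '' Tlam K q α β e := by
  have : Fact p.Prime := ⟨hp⟩
  have : CharP K p := by
    obtain ⟨r, hr⟩ := CharP.exists K
    have hr0 : r ∣ p ^ (n * 2) := by
      rw [← CharP.cast_eq_zero_iff K r, pow_mul, ← hq, ← hcard, Nat.cast_card_eq_zero]
    have hrp : r.Prime := CharP.char_is_prime K r
    rwa [← (Nat.prime_dvd_prime_iff_eq hrp hp).mp (hrp.dvd_of_dvd_pow hr0)]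
  have h2 : (2 : K) ≠ 0 := by
    refine Ring.two_ne_zero ?_
    rw [← CharP.eq K ‹CharP K p› (ringChar.charP K)]
    rintro rfl
    exact absurd hpodd (by decide)
  obtain ⟨σ, hσq⟩ : ∃ σ : K →+* K, ∀ x, x ^ q = σ x :=
    ⟨iterateFrobenius K p n, fun x => by rw [iterateFrobenius_def, hq]⟩
  have hσ : ∀ x, σ (σ x) = x := fun x => by
    rw [← hσq, ← hσq, ← pow_mul, ← sq, ← hcard, FiniteField.pow_card]
  simp only [pow_succ _ q, hσq] at hns heq
  have haniso := fun z hz => anisotropic_of_not_square σ hσ hns (z := z) hz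
  have mem_unital : ∀ x y : K, Projectivization.mk K ![x, y, 1] (vec1_ne_zero _ _) ∈
      unital K q α β ↔ y - σ y = α * x ^ 2 - σ α * σ x ^ 2 + (β - σ β) * (σ x * x) := by
    intro x y
    simp only [unital, Set.mem_ofPred_eq, mk_affine_ne_mk_infinity, or_false, mk_affine_eq_iff,
      pow_succ _ q, hσq]
    constructor
    · rintro ⟨x', r, hr, rfl, rfl⟩
      simp only [map_add, map_mul, map_pow, hσ, hr]
      ring
    · intro h
      refine ⟨x, y - α * x ^ 2 - β * (σ x * x), ?_, rfl, by ring⟩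
      simp only [map_sub, map_mul, map_pow, hσ]
      linear_combination -h
  have unital_cases : ∀ A ∈ unital K q α β,
      (∃ x y : K, A = Projectivization.mk K ![x, y, 1] (vec1_ne_zero _ _)) ∨
        A = Projectivization.mk K ![0, 1, 0] vecInf_ne_zero := by
    rintro A (⟨x, r, -, rfl⟩ | rfl)
    exacts [Or.inl ⟨x, _, rfl⟩, Or.inr rfl]
  have inf_mem : Projectivization.mk K ![0, 1, 0] vecInf_ne_zero ∈ unital K q α β := Or.inr rfl
  have y_ne : ∀ x y : K, x = 0 → Projectivization.mk K ![x, y, 1] (vec1_ne_zero _ _) ∈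
      unital K q α β → y ≠ e := by
    rintro x y rfl h rfl
    rw [mem_unital, heq] at h
    simp at h
    exact mul_ne_zero h2 he (by linear_combination h)
  ext A
  simp only [pedal, Set.mem_ofPred_eq, Set.mem_image, Tlam, Qpt, pow_succ _ q, hσq]
  constructor
  · rintro ⟨hA, htan⟩
    have huniq : ∀ B, B ∈ lineThrough (Projectivization.mk K ![0, e, 1] (vec1_ne_zero _ _)) A →
        B ∈ unital K q α β → B = A := fun B h1 h2 => htan.subset ⟨h1, h2⟩
    rcases unital_cases A hA with ⟨x, y, rfl⟩ | rfl
    · have hx : x ≠ 0 := fun hx => mk_affine_ne_mk_infinity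
        (huniq _ ((mk_infinity_mem_lineThrough_iff (y_ne x y hx hA)).mpr hx) inf_mem).symm
      rw [mem_unital] at hA
      have hw : y - e - 2 * (α * x ^ 2) - (β - σ β) * (σ x * x) = 0 := by
        refine linear_part_eq_zero σ hσ h2 he heq haniso hx fun s hs => ?_
        have := huniq _ (mk_affine_mem_lineThrough_iff.mpr ⟨1 + s, rfl, rfl⟩) (by
          rw [mem_unital]
          simp only [map_add, map_sub, map_mul, map_pow, map_one, map_ofNat, hσ, heq] at hs ⊢
          linear_combination hs + hA)
        have hsx := (mk_affine_eq_iff.mp this).1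
        simpa [hx] using (by linear_combination hsx : s * x = 0)
      have hσw := congrArg σ hw
      simp only [map_sub, map_mul, map_pow, map_zero, map_ofNat, hσ, heq] at hσw
      have hT : 2 * e + α * x ^ 2 - σ α * σ x ^ 2 + (β - σ β) * (σ x * x) = 0 := by
        linear_combination hA - hw + hσw
      refine ⟨x, hT, mk_affine_eq_iff.mpr ⟨rfl, ?_⟩⟩
      simp only [map_mul, map_pow]
      linear_combination -hw - hT
    · refine absurd (huniq (Projectivization.mk K ![0, 0, 1] (vec1_ne_zero _ _)) ?_ ?_)
        mk_affine_ne_mk_infinity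
      · rw [mem_lineThrough_mk_iff]
        refine ⟨1, -e, ?_⟩
        ext i
        fin_cases i <;> simp
      · rw [mem_unital]
        simp
  · rintro ⟨x, hT, hAx⟩
    obtain ⟨y, hy, rfl⟩ : ∃ y, α * x ^ 2 + σ (α * x ^ 2) - e = y ∧
        A = Projectivization.mk K ![x, y, 1] (vec1_ne_zero _ _) := ⟨_, rfl, hAx.symm⟩
    clear hAx
    have hx : x ≠ 0 := by
      rintro rfl
      simp [h2, he] at hT
    have hσy : σ y = y + 2 * e := by
      simp only [← hy, map_sub, map_add, map_mul, map_pow, hσ, heq]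
      ring
    have hA : Projectivization.mk K ![x, y, 1] (vec1_ne_zero _ _) ∈ unital K q α β := by
      rw [mem_unital, hσy]
      linear_combination -hT
    have hye : y ≠ e := by
      intro h
      rw [h, heq] at hσy
      exact mul_ne_zero (mul_ne_zero h2 h2) he (by linear_combination -hσy)
    refine ⟨hA, Set.Subset.antisymm ?_ ?_⟩
    · rintro B ⟨hB, hBU⟩
      rcases unital_cases B hBU with ⟨a, b, rfl⟩ | rfl
      · obtain ⟨t, rfl, rfl⟩ := mk_affine_mem_lineThrough_iff.mp hB
        rw [mem_unital] at hBU
        have ht : t - 1 = 0 := by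
          by_contra ht
          refine haniso ((t - 1) * x) (mul_ne_zero ht hx) ?_
          simp only [map_add, map_sub, map_mul, map_pow, map_one, hσy, heq] at hBU hy ⊢
          linear_combination (-1 : K) * hBU - (t - σ t) * hy + (1 - t - σ t) * hT
        rw [sub_eq_zero] at ht
        subst ht
        exact mk_affine_eq_iff.mpr ⟨by ring, by ring⟩
      · exact absurd ((mk_infinity_mem_lineThrough_iff hye).mp hB) hx
    · rintro B rfl
      exact ⟨mk_affine_mem_lineThrough_iff.mpr ⟨1, by ring, by ring⟩, hA⟩
end
end

section
/- Let x, y ∈ T_λ with x ≠ y and T(αx²) = T(αy²), and let l_{x,y} be the line through Q_x and Q_y. If Q_z ∈ l_{x,y} for some z ∈ T_λ, then Q_{−z} ∈ l_{x,y}. -/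
noncomputable section
open Projectivization
open scoped LinearAlgebra.Projectivization

/-- A line joining two distinct affine points with equal second coordinate `c` is horizontal:
its affine points are those with second coordinate `c`. -/
lemma mk_mem_lineThrough_iff_of_ne {K : Type} [Field K] {x y : K} (hxy : x ≠ y) (c z d : K) :
    Projectivization.mk K ![z, d, 1] (vec1_ne_zero _ _) ∈
      lineThrough (Projectivization.mk K ![x, c, 1] (vec1_ne_zero _ _))
        (Projectivization.mk K ![y, c, 1] (vec1_ne_zero _ _)) ↔ d = c := by
  simp only [lineThrough, Set.mem_ofPred_eq, Projectivization.submodule_mk,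
    Submodule.span_singleton_le_iff_mem, ← Submodule.span_union, Set.singleton_union,
    Submodule.mem_span_pair]
  constructor
  · rintro ⟨a, b, h⟩
    have h1 : a * c + b * c = d := by simpa using congrFun h 1
    have h2 : a + b = 1 := by simpa using congrFun h 2
    rw [← h1, ← add_mul, h2, one_mul]
  · rintro rfl
    have hne : x - y ≠ 0 := sub_ne_zero.mpr hxy
    refine ⟨(z - y) / (x - y), (x - z) / (x - y), ?_⟩
    ext i
    fin_cases i <;> simp <;> field_simp <;> ring

theorem stmt_10 {K : Type} [Field K] [Fintype K] (p n q : ℕ)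
    (hp : p.Prime) (hpodd : Odd p) (hn : 0 < n) (hq : q = p ^ n)
    (hcard : Fintype.card K = q ^ 2)
    (α β : K) (hα : α ≠ 0)
    (hns : ¬ ∃ s : K, s ^ q = s ∧ 4 * α ^ (q + 1) + (β ^ q - β) ^ 2 = s ^ 2)
    (e : K) (he : e ≠ 0) (heq : e ^ q = -e)
    (x y : K) (hx : x ∈ Tlam K q α β e) (hy : y ∈ Tlam K q α β e) (hxy : x ≠ y)
    (hT : α * x ^ 2 + (α * x ^ 2) ^ q = α * y ^ 2 + (α * y ^ 2) ^ q)
    (z : K) (hz : z ∈ Tlam K q α β e)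
    (hmem : Qpt K q α e z ∈ lineThrough (Qpt K q α e x) (Qpt K q α e y)) :
    Qpt K q α e (-z) ∈ lineThrough (Qpt K q α e x) (Qpt K q α e y) := by
  simp only [Qpt, hT] at hmem ⊢
  rw [mk_mem_lineThrough_iff_of_ne hxy] at hmem ⊢
  rw [neg_sq, hmem]
end
end

section
/- Let x, y ∈ T_λ with T(αx²) ≠ T(αy²) (so in particular Q_x ≠ Q_y), and let l_{x,y} be the line through Q_x and Q_y. Then for every z ∈ T_λ with Q_z ∈ l_{x,y}, either Q_z = Q_x or Q_z = Q_y; that is, l_{x,y} ∩ { Q_w : w ∈ T_λ } = {Q_x, Q_y}. -/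
noncomputable section
open Projectivization
open scoped LinearAlgebra.Projectivization

/-- If the quadratic form `αd² − ᾱd̄² + (β−β̄)dd̄` attached to an involution `σ` has a nontrivial
zero, then `4αᾱ + (β̄−β)²` is the square of an element fixed by `σ`. -/
lemma exists_fixed_sq_of_form_eq_zero {K : Type} [Field K] (σ : K →+* K)
    (hσ : ∀ a, σ (σ a) = a) (α β d : K) (hd : d ≠ 0)
    (h : α * d ^ 2 - σ α * σ d ^ 2 + (β - σ β) * (d * σ d) = 0) :
    ∃ s : K, σ s = s ∧ 4 * (α * σ α) + (σ β - β) ^ 2 = s ^ 2 := by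
  have hd' : σ d ≠ 0 := (map_ne_zero σ).mpr hd
  refine ⟨α * d / σ d + σ α * σ d / d, ?_, ?_⟩
  · simp only [map_add, map_mul, map_div₀, hσ]
    ring
  · have hβ : σ β - β = α * d / σ d - σ α * σ d / d := by
      field_simp
      linear_combination -h
    rw [hβ]
    field_simp
    ring

/-- A quadratic form as above takes the same value at no more than two points of a line over the
fixed field of `σ`, unless it vanishes in the direction of that line. -/
lemma eq_zero_or_eq_one_of_form_eq {K : Type} [Field K] (σ : K →+* K)
    (α β c x y t : K) (ht : σ t = t)
    (hx : c + α * x ^ 2 - σ α * σ x ^ 2 + (β - σ β) * (x * σ x) = 0)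
    (hy : c + α * y ^ 2 - σ α * σ y ^ 2 + (β - σ β) * (y * σ y) = 0)
    (hz : c + α * (x + t * (y - x)) ^ 2 - σ α * σ (x + t * (y - x)) ^ 2
      + (β - σ β) * ((x + t * (y - x)) * σ (x + t * (y - x))) = 0)
    (hd : α * (y - x) ^ 2 - σ α * σ (y - x) ^ 2 + (β - σ β) * ((y - x) * σ (y - x)) ≠ 0) :
    t = 0 ∨ t = 1 := by
  simp only [map_add, map_sub, map_mul, ht] at hz hd
  have h : t * (t - 1) = 0 := by
    refine (mul_eq_zero.mp ?_).resolve_right hd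
    linear_combination hz - (1 - t) * hx - t * hy
  rcases mul_eq_zero.mp h with h | h
  · exact Or.inl h
  · exact Or.inr (sub_eq_zero.mp h)

/-- An affine point on the line through two affine points is an affine combination of them. -/
lemma exists_affine_of_mem_lineThrough {K : Type} [Field K] {a b a' b' c d : K}
    (h : Projectivization.mk K ![c, d, 1] (vec1_ne_zero _ _) ∈
      lineThrough (Projectivization.mk K ![a, b, 1] (vec1_ne_zero _ _))
        (Projectivization.mk K ![a', b', 1] (vec1_ne_zero _ _))) :
    ∃ t : K, c = a + t * (a' - a) ∧ d = b + t * (b' - b) := by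
  simp only [lineThrough, Set.mem_ofPred_eq, Projectivization.submodule_mk] at h
  obtain ⟨u, hu, v, hv, huv⟩ := Submodule.mem_sup.mp (h (Submodule.mem_span_singleton_self _))
  obtain ⟨r, rfl⟩ := Submodule.mem_span_singleton.mp hu
  obtain ⟨t, rfl⟩ := Submodule.mem_span_singleton.mp hv
  have h0 := congrFun huv 0
  have h1 := congrFun huv 1
  have h2 := congrFun huv 2
  simp at h0 h1 h2
  refine ⟨t, ?_, ?_⟩
  · linear_combination -h0 + a * h2
  · linear_combination -h1 + b * h2

theorem stmt_11 {K : Type} [Field K] [Fintype K] (p n q : ℕ)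
    (hp : p.Prime) (hpodd : Odd p) (hn : 0 < n) (hq : q = p ^ n)
    (hcard : Fintype.card K = q ^ 2)
    (α β : K) (hα : α ≠ 0)
    (hns : ¬ ∃ s : K, s ^ q = s ∧ 4 * α ^ (q + 1) + (β ^ q - β) ^ 2 = s ^ 2)
    (e : K) (he : e ≠ 0) (heq : e ^ q = -e)
    (x y : K) (hx : x ∈ Tlam K q α β e) (hy : y ∈ Tlam K q α β e)
    (hT : α * x ^ 2 + (α * x ^ 2) ^ q ≠ α * y ^ 2 + (α * y ^ 2) ^ q) :
    lineThrough (Qpt K q α e x) (Qpt K q α e y) ∩ (Qpt K q α e '' Tlam K q α β e) =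
      {Qpt K q α e x, Qpt K q α e y} := by
  have : Fact p.Prime := ⟨hp⟩
  have hchar : CharP K p := charP_of_card_eq_prime_pow (f := n * 2) (by
    rw [hcard, hq, pow_mul])
  obtain ⟨σ, hσq⟩ : ∃ σ : K →+* K, ∀ a, a ^ q = σ a :=
    ⟨iterateFrobenius K p n, fun a => by rw [iterateFrobenius_def, hq]⟩
  have hσ : ∀ a, σ (σ a) = a := fun a => by
    rw [← hσq, ← hσq, ← pow_mul, ← sq, ← hcard, FiniteField.pow_card]
  have hN : ∀ a : K, a ^ (q + 1) = a * σ a := fun a => by rw [pow_succ, hσq, mul_comm]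
  apply Set.Subset.antisymm
  · rintro _ ⟨hline, z, hz, rfl⟩
    obtain ⟨t, hzt, hTt⟩ := exists_affine_of_mem_lineThrough hline
    simp only [Tlam, Set.mem_ofPred_eq, hN, hσq] at hx hy hz hns hT hTt
    have hD : (α * y ^ 2 + σ (α * y ^ 2)) - (α * x ^ 2 + σ (α * x ^ 2)) ≠ 0 :=
      sub_ne_zero.mpr hT.symm
    have htq : t = ((α * z ^ 2 + σ (α * z ^ 2)) - (α * x ^ 2 + σ (α * x ^ 2))) /
        ((α * y ^ 2 + σ (α * y ^ 2)) - (α * x ^ 2 + σ (α * x ^ 2))) := by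
      rw [eq_div_iff hD]
      linear_combination -hTt
    have ht : σ t = t := by
      have hfix : ∀ a, σ (a + σ a) = a + σ a := fun a => by rw [map_add, hσ, add_comm]
      rw [htq, map_div₀, map_sub, map_sub, hfix, hfix, hfix]
    have hxy : y - x ≠ 0 := fun h => hT (by rw [sub_eq_zero.mp h])
    rw [hzt] at hz
    rcases eq_zero_or_eq_one_of_form_eq σ α β (2 * e) x y t ht hx hy hz
      (fun h => hns (exists_fixed_sq_of_form_eq_zero σ hσ α β (y - x) hxy h)) with rfl | rfl
    · left
      rw [hzt]
      simp
    · right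
      rw [hzt]
      simp
  · rintro _ (rfl | rfl)
    · exact ⟨le_sup_left (α := Submodule K (Fin 3 → K)), x, hx, rfl⟩
    · exact ⟨le_sup_right (α := Submodule K (Fin 3 → K)), y, hy, rfl⟩
end
end

section
/- Every line of PG(2,q²) intersects the pedal τ_{P_λ}(U) = { Q_x : x ∈ T_λ } in at most four points. -/
noncomputable section
open Projectivization
open scoped LinearAlgebra.Projectivization

open Polynomial in
/-- The zero set of a nonzero polynomial function of degree at most four has at most four
elements. -/
lemma ncard_quartic_zeros_le {K : Type} [Field K] (a₀ a₁ a₂ a₃ a₄ : K)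
    (h : ¬ (a₀ = 0 ∧ a₁ = 0 ∧ a₂ = 0 ∧ a₃ = 0 ∧ a₄ = 0)) :
    {x : K | a₄ * x ^ 4 + a₃ * x ^ 3 + a₂ * x ^ 2 + a₁ * x + a₀ = 0}.Finite ∧
    {x : K | a₄ * x ^ 4 + a₃ * x ^ 3 + a₂ * x ^ 2 + a₁ * x + a₀ = 0}.ncard ≤ 4 := by
  classical
  set P : K[X] := C a₄ * X ^ 4 + C a₃ * X ^ 3 + C a₂ * X ^ 2 + C a₁ * X + C a₀ with hP
  have hP0 : P ≠ 0 := by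
    intro h0
    have hc : ∀ k, P.coeff k = 0 := fun k => by rw [h0, coeff_zero]
    refine h ⟨?_, ?_, ?_, ?_, ?_⟩
    · simpa [hP, coeff_X, coeff_C, coeff_X_pow] using hc 0
    · simpa [hP, coeff_X, coeff_C, coeff_X_pow] using hc 1
    · simpa [hP, coeff_X, coeff_C, coeff_X_pow] using hc 2
    · simpa [hP, coeff_X, coeff_C, coeff_X_pow] using hc 3
    · simpa [hP, coeff_X, coeff_C, coeff_X_pow] using hc 4
  have hdeg : P.natDegree ≤ 4 := by rw [hP]; compute_degree
  have hset : {x : K | a₄ * x ^ 4 + a₃ * x ^ 3 + a₂ * x ^ 2 + a₁ * x + a₀ = 0} =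
      (P.roots.toFinset : Set K) := by
    ext x
    rw [Finset.mem_coe, Multiset.mem_toFinset, mem_roots hP0]
    simp [hP, IsRoot]
  rw [hset]
  refine ⟨Finset.finite_toSet _, ?_⟩
  rw [Set.ncard_coe_finset]
  exact (Multiset.toFinset_card_le _).trans ((card_roots' P).trans hdeg)

/-- Every line of the projective plane is contained in the zero set of a nonzero linear form. -/
lemma exists_linear_form_of_isLine {K : Type} [Field K] {l : Set (Pt K)} (hl : isLine l) :
    ∃ a b c : K, ¬ (a = 0 ∧ b = 0 ∧ c = 0) ∧
      ∀ (v : Fin 3 → K) (hv : v ≠ 0), Projectivization.mk K v hv ∈ l →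
        a * v 0 + b * v 1 + c * v 2 = 0 := by
  obtain ⟨W, hW, rfl⟩ := hl
  have hlt : W < ⊤ := by
    refine lt_top_iff_ne_top.2 fun h => ?_
    rw [h, finrank_top, Module.finrank_fin_fun] at hW
    omega
  obtain ⟨f, hf, hWf⟩ := Submodule.exists_le_ker_of_lt_top W hlt
  have hfv : ∀ v : Fin 3 → K,
      f v = f (Pi.single 0 1) * v 0 + f (Pi.single 1 1) * v 1 + f (Pi.single 2 1) * v 2 := by
    intro v
    rw [LinearMap.pi_apply_eq_sum_univ f v, Fin.sum_univ_three]
    have hs : ∀ i : Fin 3, (fun j => if i = j then (1 : K) else 0) = Pi.single i 1 := by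
      intro i
      ext j
      simp [Pi.single_apply, eq_comm]
    simp only [hs, smul_eq_mul]
    ring
  refine ⟨f (Pi.single 0 1), f (Pi.single 1 1), f (Pi.single 2 1), ?_, fun v hv hvl => ?_⟩
  · rintro ⟨h0, h1, h2⟩
    apply hf
    refine LinearMap.ext fun v => ?_
    simp [hfv v, h0, h1, h2]
  · rw [← hfv]
    refine hWf (hvl ?_)
    rw [Projectivization.submodule_mk]
    exact Submodule.mem_span_singleton_self v

theorem stmt_12 {K : Type} [Field K] [Fintype K] (p n q : ℕ)
    (hp : p.Prime) (hpodd : Odd p) (hn : 0 < n) (hq : q = p ^ n)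
    (hcard : Fintype.card K = q ^ 2)
    (α β : K) (hα : α ≠ 0)
    (hns : ¬ ∃ s : K, s ^ q = s ∧ 4 * α ^ (q + 1) + (β ^ q - β) ^ 2 = s ^ 2)
    (e : K) (he : e ≠ 0) (heq : e ^ q = -e)
    (l : Set (Pt K)) (hl : isLine l) :
    (l ∩ (Qpt K q α e '' Tlam K q α β e)).ncard ≤ 4 := by
  have hpf : Fact p.Prime := ⟨hp⟩
  have : CharP K p := charP_of_card_eq_prime_pow (f := n * 2) (by
    rw [hcard, hq, pow_mul])
  have hq0 : q ≠ 0 := by rw [hq]; exact pow_ne_zero _ hp.ne_zero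
  have h2 : (2 : K) ≠ 0 := by
    refine Ring.two_ne_zero ?_
    rw [ringChar.eq K p]
    rintro rfl
    exact absurd hpodd (by decide)
  have hadd : ∀ x y : K, (x + y) ^ q = x ^ q + y ^ q := fun x y => by
    rw [hq, add_pow_char_pow]
  have hinv : ∀ x : K, (x ^ q) ^ q = x := fun x => by
    rw [← pow_mul, ← sq, ← hcard, FiniteField.pow_card]
  have hD : 4 * (α * α ^ q) + (β - β ^ q) ^ 2 ≠ 0 := by
    intro h
    refine hns ⟨0, zero_pow hq0, ?_⟩
    linear_combination h
  obtain ⟨a, b, c, habc, hline⟩ := exists_linear_form_of_isLine hl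
  suffices h : ∃ a₀ a₁ a₂ a₃ a₄ : K, ¬ (a₀ = 0 ∧ a₁ = 0 ∧ a₂ = 0 ∧ a₃ = 0 ∧ a₄ = 0) ∧
      ∀ x ∈ Tlam K q α β e, a * x + b * (α * x ^ 2 + (α * x ^ 2) ^ q - e) + c = 0 →
        a₄ * x ^ 4 + a₃ * x ^ 3 + a₂ * x ^ 2 + a₁ * x + a₀ = 0 by
    obtain ⟨a₀, a₁, a₂, a₃, a₄, hne, hx⟩ := h
    obtain ⟨hfin, hcard4⟩ := ncard_quartic_zeros_le a₀ a₁ a₂ a₃ a₄ hne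
    refine (Set.ncard_le_ncard ?_ (hfin.image (Qpt K q α e))).trans
      ((Set.ncard_image_le hfin).trans hcard4)
    rintro _ ⟨hP, x, hxT, rfl⟩
    refine ⟨x, hx x hxT ?_, rfl⟩
    simpa using hline _ _ hP
  by_cases hb : b = 0
  · refine ⟨c, a, 0, 0, 0, fun h => habc ⟨h.2.1, hb, h.1⟩, fun x _ hx => ?_⟩
    rw [hb] at hx
    linear_combination hx
  obtain ⟨m, rfl⟩ : ∃ m, a = -b * m := ⟨-(a / b), by field_simp⟩
  obtain ⟨d, rfl⟩ : ∃ d, c = -b * d := ⟨-(c / b), by field_simp⟩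
  have hsecond : ∀ x : K, -b * m * x + b * (α * x ^ 2 + (α * x ^ 2) ^ q - e) + -b * d = 0 →
      α * x ^ 2 + α ^ q * (x ^ q) ^ 2 = m * x + d + e := fun x hx => by
    refine mul_left_cancel₀ hb ?_
    rw [mul_pow, ← pow_mul, mul_comm 2 q, pow_mul] at hx
    linear_combination hx
  by_cases hm : m = 0
  · -- Eliminating `x ^ q` from the two central conics leaves a quartic.
    refine ⟨α ^ q * (d - e) ^ 2, 0,
      -(4 * α * α ^ q * (d - e) + (β - β ^ q) ^ 2 * (d + e)), 0,
      α * (4 * (α * α ^ q) + (β - β ^ q) ^ 2),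
      fun h => mul_ne_zero hα hD h.2.2.2.2, fun x hxT hx => ?_⟩
    have h1 := hsecond x hx
    have hT : 2 * e + α * x ^ 2 - α ^ q * (x ^ q) ^ 2 + (β - β ^ q) * x ^ (q + 1) = 0 := hxT
    rw [pow_succ x q] at hT
    rw [hm] at h1
    generalize x ^ q = y at *
    generalize α ^ q = α' at *
    generalize β - β ^ q = b' at *
    have h3 : b' * x * y = d - e - 2 * α * x ^ 2 := by linear_combination hT + h1
    linear_combination (-α' * (b' * x * y + (d - e - 2 * α * x ^ 2))) * h3
      + b' ^ 2 * x ^ 2 * h1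
  · -- Conjugating the equation of the line gives a second linear relation between `x` and `x ^ q`.
    have hmq : m ^ q ≠ 0 := pow_ne_zero _ hm
    obtain ⟨k, hk⟩ : ∃ k, k = d - d ^ q + 2 * e := ⟨_, rfl⟩
    refine ⟨2 * e * (m ^ q) ^ 2 - α ^ q * k ^ 2,
      k * ((β - β ^ q) * m ^ q - 2 * α ^ q * m),
      α * (m ^ q) ^ 2 - α ^ q * m ^ 2 + (β - β ^ q) * m * m ^ q, 0, 0, ?_, fun x hxT hx => ?_⟩
    · rintro ⟨h0, h1, h2', -⟩
      have hk0 : k ≠ 0 := by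
        rintro hk0
        rw [hk0] at h0
        refine mul_ne_zero (mul_ne_zero h2 he) (pow_ne_zero 2 hmq) ?_
        linear_combination h0
      have h3 := (mul_eq_zero.1 h1).resolve_left hk0
      refine mul_ne_zero (pow_ne_zero 2 hmq) hD ?_
      linear_combination 4 * α ^ q * h2' + ((β - β ^ q) * m ^ q - 2 * α ^ q * m) * h3
    · have h1 := hsecond x hx
      have h1q := congrArg (· ^ q) h1
      have hsq : ∀ z : K, (z ^ 2) ^ q = (z ^ q) ^ 2 := fun z => by
        rw [← pow_mul, mul_comm, pow_mul]
      simp only [hadd, mul_pow, hsq, hinv, heq] at h1q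
      have hT : 2 * e + α * x ^ 2 - α ^ q * (x ^ q) ^ 2 + (β - β ^ q) * x ^ (q + 1) = 0 := hxT
      rw [pow_succ x q] at hT
      have hy : m ^ q * x ^ q = m * x + k := by
        rw [hk]
        linear_combination h1 - h1q
      generalize x ^ q = y at *
      generalize m ^ q = m' at *
      generalize α ^ q = α' at *
      generalize β - β ^ q = b' at *
      linear_combination m' ^ 2 * hT + (α' * (m' * y + (m * x + k)) - b' * x * m') * hy
end
end

section
/- If x, y, z ∈ T_λ are such that Q_x, Q_y, Q_z are three pairwise distinct collinear points, then T(αx²) = T(αy²) = T(αz²), and the line containing Q_x, Q_y, Q_z passes through the point [1,0,0]. -/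
noncomputable section
open Projectivization
open scoped LinearAlgebra.Projectivization

/-- If a point moves affinely, `x = z + s (y - z)` with `s` fixed by the involution `φ`, and both the
trace form and the skew form behave affinely at `x`, then the discriminant vanishes. -/
lemma discr_eq_zero_of_affine {K : Type*} [Field K] (φ : K →+* K) (hφ : ∀ a, φ (φ a) = a)
    (α β c x y z s : K) (hs : φ s = s) (hs0 : s ≠ 0) (hs1 : s ≠ 1) (hyz : y ≠ z)
    (hx : c + α * x ^ 2 - φ α * φ x ^ 2 + (β - φ β) * (φ x * x) = 0)
    (hy : c + α * y ^ 2 - φ α * φ y ^ 2 + (β - φ β) * (φ y * y) = 0)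
    (hz : c + α * z ^ 2 - φ α * φ z ^ 2 + (β - φ β) * (φ z * z) = 0)
    (hxs : x = z + s * (y - z))
    (ht : (α * x ^ 2 + φ α * φ x ^ 2) - (α * z ^ 2 + φ α * φ z ^ 2) =
      s * ((α * y ^ 2 + φ α * φ y ^ 2) - (α * z ^ 2 + φ α * φ z ^ 2))) :
    4 * (φ α * α) + (φ β - β) ^ 2 = 0 := by
  obtain ⟨d, rfl⟩ : ∃ d, y = z + d := ⟨y - z, by ring⟩
  have hd : d ≠ 0 := fun h => hyz (by simp [h])
  have hφd : φ d ≠ 0 := (map_ne_zero φ).2 hd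
  have hφx : φ x = φ z + s * φ d := by rw [hxs]; simp [hs]
  have hx' : x = z + s * d := by rw [hxs]; ring
  rw [hφx, hx'] at hx ht
  rw [map_add] at hy ht
  have hquad : s * (s - 1) ≠ 0 := mul_ne_zero hs0 (sub_ne_zero.2 hs1)
  have h1 : α * d ^ 2 + φ α * φ d ^ 2 = 0 := by
    apply (mul_eq_zero.1 (_ : s * (s - 1) * _ = 0)).resolve_left hquad
    linear_combination ht
  have h2 : α * d ^ 2 - φ α * φ d ^ 2 + (β - φ β) * (φ d * d) = 0 := by
    apply (mul_eq_zero.1 (_ : s * (s - 1) * _ = 0)).resolve_left hquad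
    linear_combination hx - hz - s * (hy - hz)
  have h3 : 2 * α * d + (β - φ β) * φ d = 0 := by
    apply (mul_eq_zero.1 (_ : d * _ = 0)).resolve_left hd
    linear_combination h1 + h2
  have h4 : 2 * φ α * φ d + (φ β - β) * d = 0 := by
    simpa [hφ, map_ofNat φ 2] using congrArg φ h3
  apply (mul_eq_zero.1 (_ : d * φ d * _ = 0)).resolve_left (mul_ne_zero hd hφd)
  linear_combination 2 * φ α * φ d * h3 - (β - φ β) * φ d * h4

/-- Collinearity of three affine points of the projective plane as an equation. -/
lemma eq_of_dependent_affine {K : Type} [Field K] (x y z a b c : K)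
    (h : Projectivization.Dependent
      ![Projectivization.mk K ![x, a, 1] (vec1_ne_zero _ _),
        Projectivization.mk K ![y, b, 1] (vec1_ne_zero _ _),
        Projectivization.mk K ![z, c, 1] (vec1_ne_zero _ _)]) :
    (x - z) * (b - c) = (y - z) * (a - c) := by
  by_contra hne
  rw [Projectivization.dependent_iff_not_independent] at h
  apply h
  have hdet : (!![x, a, 1; y, b, 1; z, c, 1] : Matrix (Fin 3) (Fin 3) K).det ≠ 0 := by
    intro h0
    apply hne
    rw [Matrix.det_fin_three] at h0
    simp at h0
    linear_combination h0
  have hli : LinearIndependent K ![![x, a, 1], ![y, b, 1], ![z, c, 1]] :=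
    Matrix.linearIndependent_rows_of_det_ne_zero hdet
  have hnz : ∀ i, (![![x, a, 1], ![y, b, 1], ![z, c, 1]] : Fin 3 → Fin 3 → K) i ≠ 0 :=
    fun i => hli.ne_zero i
  convert Projectivization.Independent.mk _ hnz hli using 1
  funext i
  fin_cases i <;> rfl

/-- A horizontal line of the affine plane passes through `[1, 0, 0]`. -/
lemma mk_vec100_mem_lineThrough {K : Type} [Field K] (x y a : K) (hxy : x ≠ y) :
    Projectivization.mk K ![1, 0, 0] vec100_ne_zero ∈
      lineThrough (Projectivization.mk K ![x, a, 1] (vec1_ne_zero _ _))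
        (Projectivization.mk K ![y, a, 1] (vec1_ne_zero _ _)) := by
  have hsub : x - y ≠ 0 := sub_ne_zero.2 hxy
  simp only [lineThrough, Set.mem_ofPred_eq, Projectivization.submodule_mk]
  rw [Submodule.span_singleton_le_iff_mem, ← Submodule.span_insert,
    Submodule.mem_span_pair]
  refine ⟨(x - y)⁻¹, -(x - y)⁻¹, ?_⟩
  ext i
  fin_cases i <;> simp
  field_simp
  ring

theorem stmt_13 {K : Type} [Field K] [Fintype K] (p n q : ℕ)
    (hp : p.Prime) (hpodd : Odd p) (hn : 0 < n) (hq : q = p ^ n)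
    (hcard : Fintype.card K = q ^ 2)
    (α β : K) (hα : α ≠ 0)
    (hns : ¬ ∃ s : K, s ^ q = s ∧ 4 * α ^ (q + 1) + (β ^ q - β) ^ 2 = s ^ 2)
    (e : K) (he : e ≠ 0) (heq : e ^ q = -e)
    (x y z : K) (hx : x ∈ Tlam K q α β e) (hy : y ∈ Tlam K q α β e) (hz : z ∈ Tlam K q α β e)
    (hxy : Qpt K q α e x ≠ Qpt K q α e y) (hyz : Qpt K q α e y ≠ Qpt K q α e z)
    (hxz : Qpt K q α e x ≠ Qpt K q α e z)
    (hdep : Projectivization.Dependent ![Qpt K q α e x, Qpt K q α e y, Qpt K q α e z]) :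
    (α * x ^ 2 + (α * x ^ 2) ^ q = α * y ^ 2 + (α * y ^ 2) ^ q ∧
      α * y ^ 2 + (α * y ^ 2) ^ q = α * z ^ 2 + (α * z ^ 2) ^ q) ∧
    Projectivization.mk K ![1, 0, 0] vec100_ne_zero ∈
      lineThrough (Qpt K q α e x) (Qpt K q α e y) := by
  have : Fact p.Prime := ⟨hp⟩
  have hchar : CharP K p := by
    have h0 : ((p : K) ^ n) ^ 2 = 0 := by
      have := FiniteField.cast_card_eq_zero K
      rw [hcard, hq] at this
      exact_mod_cast this
    have hpK : (p : K) = 0 := pow_eq_zero_iff hn.ne' |>.1 (pow_eq_zero_iff two_ne_zero |>.1 h0)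
    exact (CharP.charP_iff_prime_eq_zero hp).2 hpK
  obtain ⟨φ, hφ⟩ : ∃ φ : K →+* K, ∀ a, a ^ q = φ a :=
    ⟨iterateFrobenius K p n, fun a => by rw [hq, iterateFrobenius_def]⟩
  have hφφ : ∀ a, φ (φ a) = a := fun a => by
    rw [← hφ, ← hφ, ← pow_mul, ← sq, ← hcard, FiniteField.pow_card]
  have hne : ∀ u v, Qpt K q α e u ≠ Qpt K q α e v → u ≠ v := fun u v h huv => h (by rw [huv])
  have hxy' := hne _ _ hxy
  have hyz' := hne _ _ hyz
  have hxz' := hne _ _ hxz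
  have hline := eq_of_dependent_affine _ _ _ _ _ _ hdep
  simp only [sub_sub_sub_cancel_right] at hline
  have key : α * y ^ 2 + (α * y ^ 2) ^ q = α * z ^ 2 + (α * z ^ 2) ^ q := by
    by_contra hb
    apply hns
    simp only [Tlam, Set.mem_ofPred_eq, pow_succ _ q, hφ] at hx hy hz
    simp only [pow_succ _ q, hφ] at hb hline ⊢
    refine ⟨0, map_zero φ, ?_⟩
    set a := α * x ^ 2 + φ (α * x ^ 2) with ha
    set b := α * y ^ 2 + φ (α * y ^ 2) with hb'
    set c := α * z ^ 2 + φ (α * z ^ 2) with hc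
    have hfix : ∀ u, φ (u + φ u) = u + φ u := fun u => by rw [map_add, hφφ, add_comm]
    have hbc : b - c ≠ 0 := sub_ne_zero.2 hb
    have hzy : y - z ≠ 0 := sub_ne_zero.2 hyz'
    have hxs : x = z + (a - c) / (b - c) * (y - z) := by
      field_simp
      linear_combination hline
    rw [zero_pow two_ne_zero]
    refine discr_eq_zero_of_affine φ hφφ α β (2 * e) x y z ((a - c) / (b - c)) ?_ ?_ ?_ hyz'
      hx hy hz hxs ?_
    · rw [map_div₀, map_sub, map_sub, hfix, hfix, hfix]
    · intro h
      exact hxz' (by rw [hxs, h]; ring)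
    · intro h
      exact hxy' (by rw [hxs, h]; ring)
    · simp only [← map_pow, ← map_mul, ← ha, ← hb', ← hc]
      field_simp
  have key' : α * x ^ 2 + (α * x ^ 2) ^ q = α * y ^ 2 + (α * y ^ 2) ^ q := by
    rw [key, sub_self, mul_zero] at hline
    rw [key]
    exact sub_eq_zero.1 ((mul_eq_zero.1 hline.symm).resolve_left (sub_ne_zero.2 hyz'))
  refine ⟨⟨key', key⟩, ?_⟩
  simp only [Qpt, key']
  exact mk_vec100_mem_lineThrough _ _ _ hxy'
end
end

section
/- For every line ℓ of PG(2,q²), the number of points in ℓ ∩ τ_{P_λ}(U) is 0, 1, 2, or 4, where τ_{P_λ}(U) = { Q_x : x ∈ T_λ }. -/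
noncomputable section
open Projectivization
open scoped LinearAlgebra.Projectivization

lemma ncard_le_two_of_quadratic {K : Type} [Field K] {A B C : K} (hA : A ≠ 0) {S : Set K}
    (hS : ∀ x ∈ S, A * x ^ 2 + B * x + C = 0) : S.ncard ≤ 2 := by
  rcases S.eq_empty_or_nonempty with rfl | ⟨u, hu⟩
  · simp
  · refine le_trans (Set.ncard_le_ncard (t := {u, -B / A - u}) ?_ (Set.toFinite _))
      ((Set.ncard_insert_le _ _).trans_eq (by rw [Set.ncard_singleton]))
    intro x hx
    have h : (x - u) * (A * (x + u) + B) = 0 := by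
      linear_combination hS x hx - hS u hu
    rcases mul_eq_zero.mp h with h | h
    · exact Or.inl (sub_eq_zero.mp h)
    · refine Or.inr ?_
      rw [Set.mem_singleton_iff, eq_sub_iff_add_eq, eq_div_iff hA]
      linear_combination h

/-- If `σ` is an involutive automorphism, the form `αX² + (β - σβ)XY - (σα)Y²` is anisotropic on
the pairs `(σm, m)` when its discriminant is not the square of an element fixed by `σ`. -/
lemma hermitian_form_ne_zero {K : Type} [Field K] (σ : K →+* K) (hσ : ∀ x, σ (σ x) = x)
    {α β : K} (hns : ¬ ∃ s : K, σ s = s ∧ 4 * (σ α * α) + (σ β - β) ^ 2 = s ^ 2)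
    {m : K} (hm : m ≠ 0) :
    α * σ m ^ 2 + (β - σ β) * (m * σ m) - σ α * m ^ 2 ≠ 0 := by
  intro h
  have hm' : σ m ≠ 0 := (map_ne_zero σ).mpr hm
  refine hns ⟨(2 * α * σ m + (β - σ β) * m) / m, ?_, ?_⟩
  · simp only [map_div₀, map_add, map_mul, map_sub, map_ofNat, hσ]
    rw [div_eq_div_iff hm' hm]
    linear_combination (-2) * h
  · rw [div_pow, eq_div_iff (pow_ne_zero 2 hm)]
    linear_combination (-4 * α) * h

/-- Intersection of the conic `T_λ` with the locus `T(αx²) = mx + k`, where `m ≠ 0`. -/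
lemma ncard_le_two_of_slope_ne_zero {K : Type} [Field K] (σ : K →+* K) (hσ : ∀ x, σ (σ x) = x)
    {α β : K} (hns : ¬ ∃ s : K, σ s = s ∧ 4 * (σ α * α) + (σ β - β) ^ 2 = s ^ 2)
    {e m k : K} (hm : m ≠ 0) {S : Set K}
    (hS : ∀ x ∈ S, 2 * e + α * x ^ 2 - σ α * σ x ^ 2 + (β - σ β) * (σ x * x) = 0 ∧
      α * x ^ 2 + σ α * σ x ^ 2 = m * x + k) : S.ncard ≤ 2 := by
  refine ncard_le_two_of_quadratic (hermitian_form_ne_zero σ hσ hns hm)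
    (B := (β - σ β) * (k - σ k) * σ m - 2 * σ α * m * (k - σ k))
    (C := 2 * e * σ m ^ 2 - σ α * (k - σ k) ^ 2) fun x hx => ?_
  obtain ⟨h₁, h₂⟩ := hS x hx
  have h₃ : σ m * σ x = m * x + (k - σ k) := by
    have h := congrArg σ h₂
    simp only [map_add, map_mul, map_pow, hσ] at h
    linear_combination h₂ - h
  linear_combination σ m ^ 2 * h₁ +
    (σ α * (σ m * σ x + m * x + (k - σ k)) - (β - σ β) * x * σ m) * h₃

/-- Intersection of the conic `T_λ` with the conic `T(αx²) = k`. -/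
lemma ncard_of_slope_eq_zero {K : Type} [Field K] (σ : K →+* K) (h2 : (2 : K) ≠ 0)
    {α β : K} (hα : α ≠ 0)
    (hns : ¬ ∃ s : K, σ s = s ∧ 4 * (σ α * α) + (σ β - β) ^ 2 = s ^ 2)
    {e k : K} (he : e ≠ 0) {S : Set K}
    (hS : ∀ x, x ∈ S ↔ 2 * e + α * x ^ 2 - σ α * σ x ^ 2 + (β - σ β) * (σ x * x) = 0 ∧
      α * x ^ 2 + σ α * σ x ^ 2 = k) : S.ncard ∈ ({0, 2, 4} : Set ℕ) := by
  have hd : 4 * (σ α * α) + (σ β - β) ^ 2 ≠ 0 := fun h => hns ⟨0, map_zero σ, by simpa using h⟩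
  have h_zero : ∀ x ∈ S, x ≠ 0 := by
    rintro x hx rfl
    have := ((hS 0).mp hx).1
    simp [h2, he] at this
  have h_neg : ∀ x ∈ S, -x ∈ S := by
    intro x hx
    rw [hS] at hx ⊢
    simpa using hx
  have h_self : ∀ x ∈ S, x ≠ -x := by
    intro x hx h
    have : 2 * x = 0 := by linear_combination h
    exact (mul_ne_zero h2 (h_zero x hx)) this
  have h_sq : ∀ x ∈ S, 2 * α * x ^ 2 = k - 2 * e - (β - σ β) * (σ x * x) := by
    intro x hx
    obtain ⟨h₁, h₂⟩ := (hS x).mp hx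
    linear_combination h₁ + h₂
  have h_norm : ∀ x ∈ S, (4 * (σ α * α) + (σ β - β) ^ 2) * (σ x * x) ^ 2 +
      4 * e * (β - σ β) * (σ x * x) + (4 * e ^ 2 - k ^ 2) = 0 := by
    intro x hx
    obtain ⟨h₁, h₂⟩ := (hS x).mp hx
    linear_combination (2 * e - α * x ^ 2 + σ α * σ x ^ 2 + (β - σ β) * (σ x * x)) * h₁ +
      (α * x ^ 2 + σ α * σ x ^ 2 + k) * h₂
  have h_sq_of_norm : ∀ x ∈ S, ∀ y ∈ S, σ x * x = σ y * y → x ^ 2 = y ^ 2 := by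
    intro x hx y hy h
    refine mul_left_cancel₀ (mul_ne_zero h2 hα) ?_
    rw [h_sq x hx, h_sq y hy, h]
  rcases S.eq_empty_or_nonempty with rfl | ⟨u, hu⟩
  · simp
  by_cases h : ∀ x ∈ S, x ^ 2 = u ^ 2
  · have : S = {u, -u} := by
      ext x
      constructor
      · exact fun hx => sq_eq_sq_iff_eq_or_eq_neg.mp (h x hx)
      · rintro (rfl | rfl)
        exacts [hu, h_neg _ hu]
    rw [this, Set.ncard_pair (h_self u hu)]
    simp
  · push Not at h
    obtain ⟨v, hv, huv⟩ := h
    have hN : σ v * v ≠ σ u * u := fun h => huv (h_sq_of_norm v hv u hu h)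
    have : S = {u, -u, v, -v} := by
      ext x
      constructor
      · intro hx
        have hsum : (4 * (σ α * α) + (σ β - β) ^ 2) * (σ v * v + σ u * u) +
            4 * e * (β - σ β) = 0 := by
          refine mul_left_cancel₀ (sub_ne_zero.mpr hN) ?_
          linear_combination h_norm v hv - h_norm u hu
        have hprod : (4 * (σ α * α) + (σ β - β) ^ 2) *
            ((σ x * x - σ u * u) * (σ x * x - σ v * v)) = 0 := by
          linear_combination h_norm x hx - h_norm u hu - (σ x * x - σ u * u) * hsum
        rcases mul_eq_zero.mp ((mul_eq_zero.mp hprod).resolve_left hd) with h | h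
        · rcases sq_eq_sq_iff_eq_or_eq_neg.mp (h_sq_of_norm x hx u hu (sub_eq_zero.mp h))
            with h | h <;> simp [h]
        · rcases sq_eq_sq_iff_eq_or_eq_neg.mp (h_sq_of_norm x hx v hv (sub_eq_zero.mp h))
            with h | h <;> simp [h]
      · rintro (rfl | rfl | rfl | rfl)
        exacts [hu, h_neg _ hu, hv, h_neg _ hv]
    have h₁ : u ≠ v := fun h => huv (by rw [h])
    have h₂ : u ≠ -v := fun h => huv (by rw [h, neg_sq])
    have h₃ : -u ≠ v := fun h => huv (by rw [← h, neg_sq])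
    have h₄ : -u ≠ -v := fun h => h₁ (neg_injective h)
    have hcard : ({u, -u, v, -v} : Set K).ncard = 4 := by
      rw [Set.ncard_insert_of_notMem (by simp [h_self u hu, h₁, h₂]),
        Set.ncard_insert_of_notMem (by
          rintro (h | h)
          exacts [h₃ h, h₄ h]),
        Set.ncard_pair (h_self v hv)]
    rw [this, hcard]
    simp

lemma isLine.exists_equation {K : Type} [Field K] {l : Set (Pt K)} (hl : isLine l) :
    ∃ a b c : K, (a ≠ 0 ∨ b ≠ 0 ∨ c ≠ 0) ∧ ∀ (v : Fin 3 → K) (hv : v ≠ 0),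
      Projectivization.mk K v hv ∈ l ↔ a * v 0 + b * v 1 + c * v 2 = 0 := by
  obtain ⟨W, hW, rfl⟩ := hl
  have hlt : W < ⊤ := by
    refine lt_top_iff_ne_top.mpr fun h => ?_
    rw [h, finrank_top] at hW
    simp at hW
  obtain ⟨f, hf, hWf⟩ := Submodule.exists_le_ker_of_lt_top W hlt
  have hker : W = LinearMap.ker f := by
    refine Submodule.eq_of_le_of_finrank_eq hWf ?_
    have := Module.Dual.finrank_ker_add_one_of_ne_zero hf
    simp only [Module.finrank_fin_fun] at this
    omega
  have hfv : ∀ v : Fin 3 → K, f v = f (Pi.single 0 1) * v 0 + f (Pi.single 1 1) * v 1 +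
      f (Pi.single 2 1) * v 2 := by
    intro v
    have hv : v = v 0 • Pi.single 0 1 + v 1 • Pi.single 1 1 + v 2 • Pi.single 2 1 := by
      ext i
      fin_cases i <;> simp
    conv_lhs => rw [hv]
    simp only [map_add, map_smul, smul_eq_mul]
    ring
  refine ⟨f (Pi.single 0 1), f (Pi.single 1 1), f (Pi.single 2 1), ?_, fun v hv => ?_⟩
  · by_contra! h
    refine hf (LinearMap.ext fun v => ?_)
    rw [hfv, h.1, h.2.1, h.2.2]
    simp
  · rw [Set.mem_ofPred_eq, Projectivization.submodule_mk, Submodule.span_singleton_le_iff_mem, hker,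
      LinearMap.mem_ker, hfv]

lemma Qpt_injective {K : Type} [Field K] (q : ℕ) (α e : K) :
    Function.Injective (Qpt K q α e) := by
  intro x y h
  obtain ⟨a, ha⟩ := (Projectivization.mk_eq_mk_iff' K _ _ _ _).mp h
  have h2 := congrFun ha 2
  have h0 := congrFun ha 0
  simp at h0 h2
  simpa [h2] using h0.symm

theorem stmt_14 {K : Type} [Field K] [Fintype K] (p n q : ℕ)
    (hp : p.Prime) (hpodd : Odd p) (hn : 0 < n) (hq : q = p ^ n)
    (hcard : Fintype.card K = q ^ 2)
    (α β : K) (hα : α ≠ 0)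
    (hns : ¬ ∃ s : K, s ^ q = s ∧ 4 * α ^ (q + 1) + (β ^ q - β) ^ 2 = s ^ 2)
    (e : K) (he : e ≠ 0) (heq : e ^ q = -e)
    (l : Set (Pt K)) (hl : isLine l) :
    (l ∩ (Qpt K q α e '' Tlam K q α β e)).ncard ∈ ({0, 1, 2, 4} : Set ℕ) := by
  have : Fact p.Prime := ⟨hp⟩
  have hchar : CharP K p := charP_of_card_eq_prime_pow (f := n * 2) (by
    rw [Fintype.card_eq_nat_card] at *
    rw [hcard, hq, pow_mul])
  have h2 : (2 : K) ≠ 0 := by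
    refine Ring.two_ne_zero ?_
    rw [ringChar.eq K p]
    rintro rfl
    exact absurd hpodd (by decide)
  set σ : K →+* K := iterateFrobenius K p n with hσ_def
  have hσ_apply : ∀ x : K, x ^ q = σ x := fun x => by
    rw [hσ_def, iterateFrobenius_def, hq]
  have hσ : ∀ x, σ (σ x) = x := fun x => by
    rw [← hσ_apply, ← hσ_apply, ← pow_mul, ← sq, ← hcard, FiniteField.pow_card]
  simp only [pow_succ _ q, hσ_apply] at hns
  obtain ⟨a, b, c, habc, hline⟩ := hl.exists_equation
  set S : Set K := {x | (2 * e + α * x ^ 2 - σ α * σ x ^ 2 + (β - σ β) * (σ x * x) = 0) ∧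
    a * x + b * (α * x ^ 2 + σ α * σ x ^ 2 - e) + c = 0} with hS
  have hset : l ∩ (Qpt K q α e '' Tlam K q α β e) = Qpt K q α e '' S := by
    have hpre : Tlam K q α β e ∩ Qpt K q α e ⁻¹' l = S := by
      ext x
      simp only [Tlam, Qpt, hS, Set.mem_inter_iff, Set.mem_preimage, hline, Set.mem_ofPred_eq,
        pow_succ _ q, hσ_apply, map_mul, map_pow]
      simp
    rw [← hpre, Set.image_inter_preimage, Set.inter_comm]
  rw [hset, Set.ncard_image_of_injective _ (Qpt_injective q α e)]
  have h_small : S.ncard ≤ 2 → S.ncard ∈ ({0, 1, 2, 4} : Set ℕ) := by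
    intro h
    interval_cases S.ncard <;> simp
  by_cases hb : b = 0
  · refine h_small (le_trans ((Set.ncard_le_one S.toFinite).mpr ?_) one_le_two)
    rintro x ⟨-, hx⟩ y ⟨-, hy⟩
    have ha : a ≠ 0 := by
      rintro rfl
      simp_all
    refine mul_left_cancel₀ ha ?_
    subst hb
    linear_combination hx - hy
  have hmem : ∀ x, x ∈ S ↔
      2 * e + α * x ^ 2 - σ α * σ x ^ 2 + (β - σ β) * (σ x * x) = 0 ∧
      α * x ^ 2 + σ α * σ x ^ 2 = -a / b * x + (e - c / b) := by
    intro x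
    refine and_congr_right fun _ => ?_
    rw [← sub_eq_zero (a := α * x ^ 2 + σ α * σ x ^ 2)]
    field_simp
    ring_nf
  by_cases ha : a = 0
  · have h := ncard_of_slope_eq_zero σ h2 hα hns he (k := e - c / b) (S := S)
      (by simpa [ha] using hmem)
    simp only [Set.mem_insert_iff, Set.mem_singleton_iff] at h ⊢
    tauto
  · exact h_small (ncard_le_two_of_slope_ne_zero σ hσ hns
      (div_ne_zero (neg_ne_zero.mpr ha) hb) fun x hx => (hmem x).mp hx)
end
end

section
/- The pedal τ_{P_λ}(U) = { Q_x : x ∈ T_λ } can be partitioned into two arcs: there exist disjoint sets A₁ and A₂ with A₁ ∪ A₂ = τ_{P_λ}(U) such that no three pairwise distinct points of A₁ are collinear and no three pairwise distinct points of A₂ are collinear. -/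
noncomputable section
open Projectivization
open scoped LinearAlgebra.Projectivization

/-- An anisotropic form: if the discriminant is not the square of a fixed element of the involution
`σ`, then `α d² - σ(α) σ(d)² + b d σ(d)` vanishes only at `d = 0`. -/
lemma eq_zero_of_form_eq_zero {K : Type} [Field K] (σ : K →+* K) (hσ : ∀ x, σ (σ x) = x)
    {α b d : K} (hb : σ b = -b)
    (hns : ¬ ∃ s : K, σ s = s ∧ 4 * (α * σ α) + b ^ 2 = s ^ 2)
    (hd : α * d ^ 2 - σ α * σ d ^ 2 + b * (d * σ d) = 0) : d = 0 := by
  by_contra hd0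
  have hσd : σ d ≠ 0 := (map_ne_zero σ).mpr hd0
  refine hns ⟨2 * σ α * (σ d / d) - b, ?_, ?_⟩
  · simp only [map_sub, map_mul, map_div₀, hσ, hb, map_ofNat]
    field_simp
    linear_combination 2 * hd
  · field_simp
    linear_combination 4 * σ α * hd

/-- Three points of an affine line whose parameters `0`, `1`, `f` are distinct and fixed by `σ`
cannot all lie on a conic with anisotropic quadratic part. -/
lemma not_three_collinear_on_conic {K : Type} [Field K] (σ : K →+* K) (hσ : ∀ x, σ (σ x) = x)
    {α b c x y z f : K} (hb : σ b = -b)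
    (hns : ¬ ∃ s : K, σ s = s ∧ 4 * (α * σ α) + b ^ 2 = s ^ 2)
    (hx : c + α * x ^ 2 - σ α * σ x ^ 2 + b * (x * σ x) = 0)
    (hy : c + α * y ^ 2 - σ α * σ y ^ 2 + b * (y * σ y) = 0)
    (hz : c + α * z ^ 2 - σ α * σ z ^ 2 + b * (z * σ z) = 0)
    (hxy : x ≠ y) (hyz : y ≠ z) (hxz : x ≠ z)
    (hf : σ f = f) (hline : z - x = f * (y - x)) : False := by
  have hline' : σ z - σ x = f * (σ y - σ x) := by
    simpa [hf] using congrArg σ hline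
  have hf0 : f ≠ 0 := by
    rintro rfl
    exact hxz (by linear_combination -hline)
  have hf1 : f - 1 ≠ 0 := by
    intro h
    exact hyz (by linear_combination -hline - (y - x) * h)
  have hz' : z = x + f * (y - x) := by linear_combination hline
  have hσz' : σ z = σ x + f * (σ y - σ x) := by linear_combination hline'
  rw [hσz', hz'] at hz
  have key : f * (f - 1) *
      (α * (y - x) ^ 2 - σ α * σ (y - x) ^ 2 + b * ((y - x) * σ (y - x))) = 0 := by
    rw [map_sub]
    linear_combination hz - (1 - f) * hx - f * hy
  have h := (mul_eq_zero.mp key).resolve_left (mul_ne_zero hf0 hf1)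
  exact hxy (sub_eq_zero.mp (eq_zero_of_form_eq_zero σ hσ hb hns h)).symm

/-- Two conics `α x² - α' y² + b x y = const` and `α x² + α' y² = const` meet in at most two pairs
of opposite points. -/
lemma exists_opposite_of_two_conics {K : Type} [Field K] (h2 : (2 : K) ≠ 0)
    {α α' b c m x₁ x₂ x₃ y₁ y₂ y₃ : K} (hα : α ≠ 0)
    (hD : 4 * (α * α') + b ^ 2 ≠ 0)
    (h₁ : c + α * x₁ ^ 2 - α' * y₁ ^ 2 + b * (x₁ * y₁) = 0)
    (h₂ : c + α * x₂ ^ 2 - α' * y₂ ^ 2 + b * (x₂ * y₂) = 0)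
    (h₃ : c + α * x₃ ^ 2 - α' * y₃ ^ 2 + b * (x₃ * y₃) = 0)
    (m₁ : α * x₁ ^ 2 + α' * y₁ ^ 2 = m) (m₂ : α * x₂ ^ 2 + α' * y₂ ^ 2 = m)
    (m₃ : α * x₃ ^ 2 + α' * y₃ ^ 2 = m)
    (h₁₂ : x₁ ≠ x₂) (h₂₃ : x₂ ≠ x₃) (h₁₃ : x₁ ≠ x₃) :
    x₁ = -x₂ ∨ x₂ = -x₃ ∨ x₁ = -x₃ := by
  have opposite : ∀ {x y x' y' : K}, c + α * x ^ 2 - α' * y ^ 2 + b * (x * y) = 0 →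
      c + α * x' ^ 2 - α' * y' ^ 2 + b * (x' * y') = 0 → α * x ^ 2 + α' * y ^ 2 = m →
      α * x' ^ 2 + α' * y' ^ 2 = m → x ≠ x' → x * y = x' * y' → x = -x' := by
    intro x y x' y' h h' k k' hne hu
    have hsq : 2 * α * ((x - x') * (x + x')) = 0 := by
      linear_combination h - h' + k - k' - b * hu
    have := (mul_eq_zero.mp hsq).resolve_left (mul_ne_zero h2 hα)
    exact eq_neg_of_add_eq_zero_left
      ((mul_eq_zero.mp this).resolve_left (sub_ne_zero.mpr hne))
  have quadratic : ∀ {x y : K}, c + α * x ^ 2 - α' * y ^ 2 + b * (x * y) = 0 →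
      α * x ^ 2 + α' * y ^ 2 = m →
      (4 * (α * α') + b ^ 2) * (x * y) ^ 2 + 2 * b * c * (x * y) + c ^ 2 - m ^ 2 = 0 := by
    intro x y h k
    linear_combination (c + b * (x * y) - α * x ^ 2 + α' * y ^ 2) * h +
      (α * x ^ 2 + α' * y ^ 2 + m) * k
  have q₁ := quadratic h₁ m₁
  have q₂ := quadratic h₂ m₂
  have q₃ := quadratic h₃ m₃
  by_contra! hno
  have u₁₂ : x₁ * y₁ - x₂ * y₂ ≠ 0 :=
    fun h => hno.1 (opposite h₁ h₂ m₁ m₂ h₁₂ (sub_eq_zero.mp h))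
  have u₂₃ : x₂ * y₂ - x₃ * y₃ ≠ 0 :=
    fun h => hno.2.1 (opposite h₂ h₃ m₂ m₃ h₂₃ (sub_eq_zero.mp h))
  have u₁₃ : x₁ * y₁ - x₃ * y₃ ≠ 0 :=
    fun h => hno.2.2 (opposite h₁ h₃ m₁ m₃ h₁₃ (sub_eq_zero.mp h))
  refine mul_ne_zero (mul_ne_zero (mul_ne_zero hD u₁₂) u₂₃) u₁₃ ?_
  linear_combination (x₂ * y₂ - x₃ * y₃) * q₁ - (x₁ * y₁ - x₃ * y₃) * q₂ +
    (x₁ * y₁ - x₂ * y₂) * q₃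

lemma exists_opposite_of_det_eq_zero {K : Type} [Field K] (σ : K →+* K)
    (hσ : ∀ x, σ (σ x) = x) (h2 : (2 : K) ≠ 0) {α b c x y z : K} (hα : α ≠ 0) (hb : σ b = -b)
    (hns : ¬ ∃ s : K, σ s = s ∧ 4 * (α * σ α) + b ^ 2 = s ^ 2)
    (hx : c + α * x ^ 2 - σ α * σ x ^ 2 + b * (x * σ x) = 0)
    (hy : c + α * y ^ 2 - σ α * σ y ^ 2 + b * (y * σ y) = 0)
    (hz : c + α * z ^ 2 - σ α * σ z ^ 2 + b * (z * σ z) = 0)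
    (hxy : x ≠ y) (hyz : y ≠ z) (hxz : x ≠ z)
    (hdet : (y - x) * ((α * z ^ 2 + σ α * σ z ^ 2) - (α * x ^ 2 + σ α * σ x ^ 2)) =
      (z - x) * ((α * y ^ 2 + σ α * σ y ^ 2) - (α * x ^ 2 + σ α * σ x ^ 2))) :
    x = -y ∨ y = -z ∨ x = -z := by
  have htr : ∀ t, σ (α * t ^ 2 + σ α * σ t ^ 2) = α * t ^ 2 + σ α * σ t ^ 2 := by
    intro t
    simp only [map_add, map_mul, map_pow, hσ]
    ring
  by_cases hM : (α * y ^ 2 + σ α * σ y ^ 2) - (α * x ^ 2 + σ α * σ x ^ 2) = 0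
  · rw [hM, mul_zero] at hdet
    have hM' := (mul_eq_zero.mp hdet).resolve_left (sub_ne_zero.mpr hxy.symm)
    exact exists_opposite_of_two_conics h2 hα
      (fun h => hns ⟨0, map_zero σ, by rw [h]; ring⟩) hx hy hz rfl
      (sub_eq_zero.mp hM) (sub_eq_zero.mp hM') hxy hyz hxz
  · refine (not_three_collinear_on_conic σ hσ hb hns hx hy hz hxy hyz hxz (f :=
      ((α * z ^ 2 + σ α * σ z ^ 2) - (α * x ^ 2 + σ α * σ x ^ 2)) /
      ((α * y ^ 2 + σ α * σ y ^ 2) - (α * x ^ 2 + σ α * σ x ^ 2))) ?_ ?_).elim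
    · rw [map_div₀, map_sub, map_sub, htr, htr, htr]
    · rw [div_mul_eq_mul_div, eq_div_iff hM]
      linear_combination -hdet

lemma det_eq_zero_of_dependent {K : Type} [Field K] {u v w : Fin 3 → K} (hu : u ≠ 0) (hv : v ≠ 0)
    (hw : w ≠ 0)
    (h : Projectivization.Dependent ![Projectivization.mk K u hu, Projectivization.mk K v hv,
      Projectivization.mk K w hw]) :
    (Matrix.of ![u, v, w]).det = 0 := by
  by_contra hdet
  rw [Projectivization.dependent_iff_not_independent] at h
  refine h ?_
  have hli : LinearIndependent K ![u, v, w] := Matrix.linearIndependent_rows_of_det_ne_zero hdet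
  have hne : ∀ i, ![u, v, w] i ≠ 0 := fun i => hli.ne_zero i
  convert Projectivization.Independent.mk ![u, v, w] hne hli using 1
  funext i
  fin_cases i <;> rfl

/-- In characteristic different from two, a set avoiding `0` is the disjoint union of two parts, each
meeting every pair `{x, -x}` at most once. -/
lemma exists_partition_no_opposite {K : Type} [Field K] (h2 : (2 : K) ≠ 0) (T : Set K)
    (hT : (0 : K) ∉ T) :
    ∃ S₁ S₂ : Set K, Disjoint S₁ S₂ ∧ S₁ ∪ S₂ = T ∧ (∀ x ∈ S₁, -x ∉ S₁) ∧
      (∀ x ∈ S₂, -x ∉ S₂) := by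
  let r : K → K → Prop := WellOrderingRel
  refine ⟨{x ∈ T | r x (-x)}, {x ∈ T | r (-x) x}, ?_, ?_, ?_, ?_⟩
  · rw [Set.disjoint_left]
    rintro x ⟨-, h⟩ ⟨-, h'⟩
    exact asymm_of r h h'
  · ext x
    refine ⟨fun h => h.elim And.left And.left, fun hx => ?_⟩
    have hne : x ≠ -x := by
      intro h
      have : 2 * x = 0 := by linear_combination h
      exact hT ((mul_eq_zero.mp this).resolve_left h2 ▸ hx)
    rcases trichotomous_of r x (-x) with h | h | h
    · exact Or.inl ⟨hx, h⟩
    · exact (hne h).elim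
    · exact Or.inr ⟨hx, h⟩
  · rintro x ⟨-, h⟩ ⟨-, h'⟩
    rw [neg_neg] at h'
    exact asymm_of r h h'
  · rintro x ⟨-, h⟩ ⟨-, h'⟩
    rw [neg_neg] at h'
    exact asymm_of r h h'

theorem stmt_15 {K : Type} [Field K] [Fintype K] (p n q : ℕ)
    (hp : p.Prime) (hpodd : Odd p) (hn : 0 < n) (hq : q = p ^ n)
    (hcard : Fintype.card K = q ^ 2)
    (α β : K) (hα : α ≠ 0)
    (hns : ¬ ∃ s : K, s ^ q = s ∧ 4 * α ^ (q + 1) + (β ^ q - β) ^ 2 = s ^ 2)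
    (e : K) (he : e ≠ 0) (heq : e ^ q = -e) :
    ∃ A₁ A₂ : Set (Pt K), Disjoint A₁ A₂ ∧
      A₁ ∪ A₂ = Qpt K q α e '' Tlam K q α β e ∧
      (∀ X Y Z : Pt K, X ∈ A₁ → Y ∈ A₁ → Z ∈ A₁ → X ≠ Y → Y ≠ Z → X ≠ Z →
        ¬ Projectivization.Dependent ![X, Y, Z]) ∧
      (∀ X Y Z : Pt K, X ∈ A₂ → Y ∈ A₂ → Z ∈ A₂ → X ≠ Y → Y ≠ Z → X ≠ Z →
        ¬ Projectivization.Dependent ![X, Y, Z]) := by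
  have := Fact.mk hp
  have : CharP K p := charP_of_card_eq_prime_pow (f := n * 2) (by rw [hcard, hq, pow_mul])
  have h2 : (2 : K) ≠ 0 := by
    apply Ring.two_ne_zero
    rw [ringChar.eq K p]
    rintro rfl
    exact absurd hpodd (by decide)
  let σ : K →+* K := iterateFrobenius K p n
  have hσq : ∀ x, x ^ q = σ x := fun x => by rw [hq]; rfl
  have hσ : ∀ x, σ (σ x) = x := fun x => by
    rw [← hσq, ← hσq, ← pow_mul, ← sq, ← hcard, FiniteField.pow_card]
  have hb : σ (β - σ β) = -(β - σ β) := by rw [map_sub, hσ]; ring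
  have hns' : ¬ ∃ s : K, σ s = s ∧ 4 * (α * σ α) + (β - σ β) ^ 2 = s ^ 2 := by
    rintro ⟨s, hs, h⟩
    refine hns ⟨s, by rw [hσq, hs], ?_⟩
    rw [pow_succ, hσq, hσq, ← h]
    ring
  have hT : ∀ x ∈ Tlam K q α β e,
      2 * e + α * x ^ 2 - σ α * σ x ^ 2 + (β - σ β) * (x * σ x) = 0 := by
    intro x hx
    have h : _ = (0 : K) := hx
    rw [pow_succ x q, hσq, hσq, hσq] at h
    linear_combination h
  have h0 : (0 : K) ∉ Tlam K q α β e := by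
    intro h
    have := hT 0 h
    simp [h2, he] at this
  have arc : ∀ S ⊆ Tlam K q α β e, (∀ x ∈ S, -x ∉ S) → ∀ X Y Z : Pt K,
      X ∈ Qpt K q α e '' S → Y ∈ Qpt K q α e '' S → Z ∈ Qpt K q α e '' S →
      X ≠ Y → Y ≠ Z → X ≠ Z → ¬ Projectivization.Dependent ![X, Y, Z] := by
    rintro S hS hopp _ _ _ ⟨x, hx, rfl⟩ ⟨y, hy, rfl⟩ ⟨z, hz, rfl⟩ hxy hyz hxz hdep
    have hdet := det_eq_zero_of_dependent _ _ _ hdep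
    simp only [hσq, map_mul, map_pow, Matrix.det_fin_three, Matrix.of_apply, Matrix.cons_val]
      at hdet
    rcases exists_opposite_of_det_eq_zero σ hσ h2 hα hb hns' (hT x (hS hx)) (hT y (hS hy))
      (hT z (hS hz)) (ne_of_apply_ne _ hxy) (ne_of_apply_ne _ hyz) (ne_of_apply_ne _ hxz)
      (by linear_combination hdet) with h | h | h
    · exact hopp y hy (h ▸ hx)
    · exact hopp z hz (h ▸ hy)
    · exact hopp z hz (h ▸ hx)
  obtain ⟨S₁, S₂, hdisj, hunion, hS₁, hS₂⟩ := exists_partition_no_opposite h2 _ h0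
  refine ⟨Qpt K q α e '' S₁, Qpt K q α e '' S₂,
    (Set.disjoint_image_iff (Qpt_injective q α e)).mpr hdisj, ?_,
    arc S₁ (hunion ▸ Set.subset_union_left) hS₁, arc S₂ (hunion ▸ Set.subset_union_right) hS₂⟩
  rw [← Set.image_union, hunion]
end
end

section
/- Suppose in addition that β = β̄ (i.e. β ∈ GF(q)). Then the pedal τ_{P_λ}(U) = { Q_x : x ∈ T_λ } is an arc: no three pairwise distinct points of τ_{P_λ}(U) are collinear. Equivalently, if x, y, z ∈ T_λ with x ≠ y and Q_z lies on the line through Q_x and Q_y, then z = x or z = y. -/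
noncomputable section
open Projectivization
open scoped LinearAlgebra.Projectivization

/-- If `β ∈ GF(q)`, then every `Q_x` with `x ∈ T_λ` lies on the conic `Y = 2αX² + e`. -/
lemma Qpt_eq_conic {K : Type} [Field K] {q : ℕ} {α β e x : K} (hβ : β ^ q = β)
    (hx : x ∈ Tlam K q α β e) :
    Qpt K q α e x = Projectivization.mk K ![x, 2 * α * x ^ 2 + e, 1] (vec1_ne_zero _ _) := by
  have h : (α * x ^ 2) + (α * x ^ 2) ^ q - e = 2 * α * x ^ 2 + e := by
    have hx' : 2 * e + α * x ^ 2 - α ^ q * (x ^ q) ^ 2 + (β - β ^ q) * x ^ (q + 1) = 0 := hx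
    rw [hβ] at hx'
    rw [mul_pow, pow_right_comm]
    linear_combination -hx'
  simp only [Qpt, h]

/-- Three distinct affine points of the conic `Y = cX² + e` are not collinear. -/
lemma linearIndependent_conic {K : Type} [Field K] {c e x y z : K} (hc : c ≠ 0)
    (hxy : x ≠ y) (hyz : y ≠ z) (hxz : x ≠ z) :
    LinearIndependent K
      ![![x, c * x ^ 2 + e, 1], ![y, c * y ^ 2 + e, 1], ![z, c * z ^ 2 + e, 1]] := by
  refine Matrix.linearIndependent_rows_of_det_ne_zero
    (A := Matrix.of ![![x, c * x ^ 2 + e, 1], ![y, c * y ^ 2 + e, 1], ![z, c * z ^ 2 + e, 1]]) ?_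
  have h : Matrix.det
      (Matrix.of ![![x, c * x ^ 2 + e, 1], ![y, c * y ^ 2 + e, 1], ![z, c * z ^ 2 + e, 1]]) =
      c * (x - y) * (y - z) * (x - z) * -1 := by
    simp [Matrix.det_fin_three]
    ring
  rw [h]
  simp [hc, sub_ne_zero, hxy, hyz, hxz]

theorem stmt_16 {K : Type} [Field K] [Fintype K] (p n q : ℕ)
    (hp : p.Prime) (hpodd : Odd p) (hn : 0 < n) (hq : q = p ^ n)
    (hcard : Fintype.card K = q ^ 2)
    (α β : K) (hα : α ≠ 0)
    (hns : ¬ ∃ s : K, s ^ q = s ∧ 4 * α ^ (q + 1) + (β ^ q - β) ^ 2 = s ^ 2)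
    (e : K) (he : e ≠ 0) (heq : e ^ q = -e)
    (hβ : β ^ q = β) :
    (∀ X Y Z : Pt K, X ∈ Qpt K q α e '' Tlam K q α β e → Y ∈ Qpt K q α e '' Tlam K q α β e →
        Z ∈ Qpt K q α e '' Tlam K q α β e → X ≠ Y → Y ≠ Z → X ≠ Z →
        ¬ Projectivization.Dependent ![X, Y, Z]) ∧
    (∀ x y z : K, x ∈ Tlam K q α β e → y ∈ Tlam K q α β e → z ∈ Tlam K q α β e → x ≠ y →
        Qpt K q α e z ∈ lineThrough (Qpt K q α e x) (Qpt K q α e y) → z = x ∨ z = y) := by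
  have hq0 : q ≠ 0 := by
    rw [hq]
    exact pow_ne_zero _ hp.ne_zero
  have h2 : (2 : K) ≠ 0 := by
    intro h2
    refine hns ⟨0, zero_pow hq0, ?_⟩
    rw [hβ]
    linear_combination 2 * α ^ (q + 1) * h2
  have hc : 2 * α ≠ 0 := mul_ne_zero h2 hα
  constructor
  · rintro _ _ _ ⟨x, hx, rfl⟩ ⟨y, hy, rfl⟩ ⟨z, hz, rfl⟩ hXY hYZ hXZ
    rw [← Projectivization.independent_iff_not_dependent]
    have hli := linearIndependent_conic (e := e) hc (ne_of_apply_ne _ hXY) (ne_of_apply_ne _ hYZ)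
      (ne_of_apply_ne _ hXZ)
    convert Projectivization.Independent.mk _ (fun i => hli.ne_zero i) hli using 1
    funext i
    fin_cases i
    · exact Qpt_eq_conic hβ hx
    · exact Qpt_eq_conic hβ hy
    · exact Qpt_eq_conic hβ hz
  · intro x y z hx hy hz hxy hmem
    rw [Qpt_eq_conic hβ hx, Qpt_eq_conic hβ hy, Qpt_eq_conic hβ hz] at hmem
    simp only [lineThrough, Set.mem_ofPred_eq, Projectivization.submodule_mk,
      Submodule.span_singleton_le_iff_mem, ← Submodule.span_union, Set.singleton_union,
      Submodule.mem_span_pair] at hmem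
    obtain ⟨a, b, hab⟩ := hmem
    have h0 : a * x + b * y = z := by simpa using congrFun hab 0
    have h1 : a * (2 * α * x ^ 2 + e) + b * (2 * α * y ^ 2 + e) = 2 * α * z ^ 2 + e := by
      simpa using congrFun hab 1
    have h3 : a + b = 1 := by simpa using congrFun hab 2
    have key : 2 * α * ((z - x) * (z - y)) = 0 := by
      linear_combination -h1 + 2 * α * (x + y) * h0 + (e - 2 * α * x * y) * h3
    rcases mul_eq_zero.mp ((mul_eq_zero.mp key).resolve_left hc) with h | h
    · exact Or.inl (sub_eq_zero.mp h)
    · exact Or.inr (sub_eq_zero.mp h)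
end
end
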